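/- arXiv:2512.00616 — 8 statements merged into one kernel-verified Lean document; each statement's English description precedes it below -/
import Mathlib

section
/- For any ordinal margin matrix M with at most 4 alternatives, every SSV-SE (Simple Stable Voting with Simultaneous Elimination) winner of M is a Split Cycle winner of M. -/
variable {X : Type} [DecidableEq X]

/-- `(V, succ)` is an ordinal margin matrix: `V` is a nonempty (finite) set of alternatives
and `succ` (the relation `≻`) is asymmetric, negatively transitive, and ordinally
skew-symmetric on `V × V`. -/
def IsOMM (V : Finset X) (succ : X × X → X × X → Prop) : Prop :=
  V.Nonempty ∧
  (∀ p q : X × X, p.1 ∈ V → p.2 ∈ V → q.1 ∈ V → q.2 ∈ V → succ p q → ¬ succ q p) ∧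
  (∀ p q r : X × X, p.1 ∈ V → p.2 ∈ V → q.1 ∈ V → q.2 ∈ V → r.1 ∈ V → r.2 ∈ V →
      ¬ succ p q → ¬ succ q r → ¬ succ p r) ∧
  (∀ a b c d : X, a ∈ V → b ∈ V → c ∈ V → d ∈ V →
      (succ (a, b) (c, d) ↔ succ (d, c) (b, a)))

/-- A linear ordinal margin matrix: additionally `≻` is connected on pairs of
distinct alternatives, hence a strict linear order there. -/
def IsLinearOMM (V : Finset X) (succ : X × X → X × X → Prop) : Prop :=
  IsOMM V succ ∧
  ∀ a b c d : X, a ∈ V → b ∈ V → c ∈ V → d ∈ V → a ≠ b → c ≠ d → (a, b) ≠ (c, d) →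
    (succ (a, b) (c, d) ∨ succ (c, d) (a, b))

/-- `a` defeats `b` according to Split Cycle in `(V, succ)`: `(a,b) ≻ (b,a)` and there is no
cycle in the majority graph (a duplicate-free list `l` of vertices of `V` whose consecutive
steps, including the wrap-around step — i.e. all the pairs of `l.zip (l.rotate 1)` — are
majority edges) such that `(a,b)` is an edge of the cycle that is weakest in the cycle,
i.e. `(a,b)` is not `≻`-stronger than any edge of the cycle. -/
def SCdefeats (V : Finset X) (succ : X × X → X × X → Prop) (a b : X) : Prop :=
  a ∈ V ∧ b ∈ V ∧ succ (a, b) (b, a) ∧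
    ¬ ∃ l : List X, l.Nodup ∧ (∀ x ∈ l, x ∈ V) ∧
        (∀ e ∈ l.zip (l.rotate 1), succ (e.1, e.2) (e.2, e.1)) ∧
        (a, b) ∈ l.zip (l.rotate 1) ∧
        (∀ e ∈ l.zip (l.rotate 1), ¬ succ (a, b) (e.1, e.2))

/-- `a` is a Split Cycle winner in `(V, succ)`: `a` is not defeated by any alternative. -/
def SCwinner (V : Finset X) (succ : X × X → X × X → Prop) (a : X) : Prop :=
  a ∈ V ∧ ∀ b ∈ V, ¬ SCdefeats V succ b a

/-- Auxiliary definition of Simple Stable Voting winners, by recursion on a fuel parameter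
that is always instantiated to the cardinality of the set of alternatives (deleting a member
of `V` decreases the cardinality by exactly one, so the fuel always matches). -/
def SSVwinAux (succ : X × X → X × X → Prop) : ℕ → Finset X → X → Prop
  | 0, _, _ => False
  | n + 1, V, a =>
      V = {a} ∨
        (1 < V.card ∧ ∃ b ∈ V, a ∈ V.erase b ∧ SSVwinAux succ n (V.erase b) a ∧
          ∀ c d : X, d ∈ V → c ∈ V.erase d → (c, d) ≠ (a, b) →
            SSVwinAux succ n (V.erase d) c → succ (a, b) (c, d))

/-- `a` is a Simple Stable Voting (SSV) winner in `(V, succ)`: either `V = {a}`, or there is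
`b` such that `a` is the SSV winner of `V` with `b` deleted and `(a,b)` is the `≻`-maximal
pair `(c,d)` of distinct alternatives such that `c` is the SSV winner of `V` with `d`
deleted (i.e. `(a,b)` is `≻`-stronger than every other such pair). -/
def SSVwin (V : Finset X) (succ : X × X → X × X → Prop) (a : X) : Prop :=
  SSVwinAux succ V.card V a

/-- Auxiliary definition of Stable Voting winners (fuel-indexed as in `SSVwinAux`). -/
def SVwinAux (succ : X × X → X × X → Prop) : ℕ → Finset X → X → Prop
  | 0, _, _ => False
  | n + 1, V, a =>
      V = {a} ∨
        (1 < V.card ∧ ∃ b ∈ V, a ∈ V.erase b ∧ SCwinner V succ a ∧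
          SVwinAux succ n (V.erase b) a ∧
          ∀ c d : X, d ∈ V → c ∈ V.erase d → (c, d) ≠ (a, b) →
            SCwinner V succ c → SVwinAux succ n (V.erase d) c → succ (a, b) (c, d))

/-- `a` is a Stable Voting (SV) winner in `(V, succ)`: like SSV, but the witnessing pairs
`(c,d)` must additionally have `c` a Split Cycle winner of `(V, succ)`. -/
def SVwin (V : Finset X) (succ : X × X → X × X → Prop) (a : X) : Prop :=
  SVwinAux succ V.card V a

/-- Auxiliary definition of SSV-SE winners (fuel-indexed as in `SSVwinAux`). -/
def SSVSEwinAux (succ : X × X → X × X → Prop) : ℕ → Finset X → X → Prop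
  | 0, _, _ => False
  | n + 1, V, a =>
      V = {a} ∨
        (1 < V.card ∧ ∃ b ∈ V, a ∈ V.erase b ∧ SSVSEwinAux succ n (V.erase b) a ∧
          ∀ c d : X, d ∈ V → c ∈ V.erase d → SSVSEwinAux succ n (V.erase d) c →
            ¬ succ (c, d) (a, b))

/-- `a` is a Simple Stable Voting with Simultaneous Elimination (SSV-SE) winner in
`(V, succ)`: either `V = {a}`, or `a` is the first coordinate of a `≻`-maximal element
`(a,b)` of the set of pairs `(c,d)` of distinct alternatives such that `c` is an SSV-SE
winner of `V` with `d` deleted (maximal: no such pair is `≻`-stronger than `(a,b)`). -/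
def SSVSEwin (V : Finset X) (succ : X × X → X × X → Prop) (a : X) : Prop :=
  SSVSEwinAux succ V.card V a

/-- `succ'` is a linearization of `succ` on `V`: `succ'` is a linear ordinal margin matrix
relation on `V` extending `succ` on `V`. -/
def IsLinearization (V : Finset X) (succ succ' : X × X → X × X → Prop) : Prop :=
  IsLinearOMM V succ' ∧
  ∀ p q : X × X, p.1 ∈ V → p.2 ∈ V → q.1 ∈ V → q.2 ∈ V → succ p q → succ' p q

/-- `a` is an SSV-PUT (parallel-universe tiebreaking) winner in `(V, succ)`:
`a` is the SSV winner of some linearization of `(V, succ)`. -/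
def SSVPUTwin (V : Finset X) (succ : X × X → X × X → Prop) (a : X) : Prop :=
  ∃ succ' : X × X → X × X → Prop, IsLinearization V succ succ' ∧ SSVwin V succ' a

/-- `r` is a strict linear order on (the elements of) `V`. -/
def IsLinOrderOn (V : Finset X) (r : X → X → Prop) : Prop :=
  (∀ a ∈ V, ¬ r a a) ∧
  (∀ a ∈ V, ∀ b ∈ V, ∀ c ∈ V, r a b → r b c → r a c) ∧
  (∀ a ∈ V, ∀ b ∈ V, a ≠ b → (r a b ∨ r b a))

open Classical in
/-- The margin of `a` vs. `b` in the profile `P` with voters `Fin m`: the number of voters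
ranking `a` above `b` minus the number of voters ranking `b` above `a`. -/
noncomputable def margin {m : ℕ} (P : Fin m → X → X → Prop) (a b : X) : ℤ :=
  ((Finset.univ.filter fun i => P i a b).card : ℤ) -
  ((Finset.univ.filter fun i => P i b a).card : ℤ)

theorem omm_mono {X : Type} [DecidableEq X] {V W : Finset X}
    {succ : X × X → X × X → Prop} (h : IsOMM V succ) (hW : W ⊆ V) (hn : W.Nonempty) :
    IsOMM W succ := by
  obtain ⟨_, h1, h2, h3⟩ := h
  refine ⟨hn, ?_, ?_, ?_⟩
  · intro p q a b c d
    exact h1 p q (hW a) (hW b) (hW c) (hW d)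
  · intro p q r a b c d e f
    exact h2 p q r (hW a) (hW b) (hW c) (hW d) (hW e) (hW f)
  · intro p q r s a b c d
    exact h3 p q r s (hW a) (hW b) (hW c) (hW d)

theorem scdefeats_anti {X : Type} [DecidableEq X] {V W : Finset X}
    {succ : X × X → X × X → Prop} (hW : W ⊆ V) {a b : X} (ha : a ∈ W) (hb : b ∈ W)
    (hd : SCdefeats V succ a b) : SCdefeats W succ a b := by
  obtain ⟨_, _, h3, h4⟩ := hd
  refine ⟨ha, hb, h3, ?_⟩
  rintro ⟨l, l1, l2, l3⟩
  exact h4 ⟨l, l1, fun x hx => hW (l2 x hx), l3⟩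

theorem exists_max_of_weak {Y : Type} (R : Y → Y → Prop) (S : Finset Y) (hS : S.Nonempty) :
    (∀ p ∈ S, ∀ q ∈ S, R p q → ¬ R q p) →
    (∀ p ∈ S, ∀ q ∈ S, ∀ r ∈ S, ¬ R p q → ¬ R q r → ¬ R p r) →
    ∃ m ∈ S, ∀ x ∈ S, ¬ R x m := by
  classical
  induction hS using Finset.Nonempty.cons_induction with
  | singleton a =>
    intro h1 _
    refine ⟨a, by simp, ?_⟩
    intro x hx hR
    rw [Finset.mem_singleton] at hx
    subst hx
    exact h1 x (by simp) x (by simp) hR hR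
  | cons a s ha hs ih =>
    intro h1 h2
    obtain ⟨m, hm, hmax⟩ := ih
      (fun p hp q hq => h1 p (Finset.mem_cons_of_mem hp) q (Finset.mem_cons_of_mem hq))
      (fun p hp q hq r hr => h2 p (Finset.mem_cons_of_mem hp) q (Finset.mem_cons_of_mem hq)
        r (Finset.mem_cons_of_mem hr))
    have has : a ∈ Finset.cons a s ha := Finset.mem_cons_self a s
    have hms : m ∈ Finset.cons a s ha := Finset.mem_cons_of_mem hm
    by_cases hR : R a m
    · refine ⟨a, has, ?_⟩
      intro x hx hxa
      rcases Finset.mem_cons.1 hx with rfl | hxs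
      · exact h1 x has x has hxa hxa
      · exact h2 x hx m hms a has (hmax x hxs) (h1 a has m hms hR) hxa
    · refine ⟨m, hms, ?_⟩
      intro x hx
      rcases Finset.mem_cons.1 hx with rfl | hxs
      · exact hR
      · exact hmax x hxs

theorem ssvse_mem {X : Type} [DecidableEq X] (succ : X × X → X × X → Prop) (n : ℕ)
    (V : Finset X) (a : X) (h : SSVSEwinAux succ n V a) : a ∈ V := by
  cases n with
  | zero => exact h.elim
  | succ n =>
    rcases h with h | ⟨_, b, _, hab, _⟩
    · simp [h]
    · exact Finset.mem_of_mem_erase hab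

theorem ssvse_exists {X : Type} [DecidableEq X] (succ : X × X → X × X → Prop) (n : ℕ) :
    ∀ V : Finset X, IsOMM V succ → V.card = n → ∃ a, SSVSEwinAux succ n V a := by
  classical
  induction n with
  | zero =>
    intro V h hc
    have := h.1.card_pos
    omega
  | succ n ih =>
    intro V h hc
    by_cases h1 : V.card = 1
    · obtain ⟨a, ha⟩ := Finset.card_eq_one.1 h1
      exact ⟨a, Or.inl ha⟩
    · have hlt : 1 < V.card := by
        have := h.1.card_pos
        omega
      let S := (V ×ˢ V).filter fun p => p.1 ∈ V.erase p.2 ∧ SSVSEwinAux succ n (V.erase p.2) p.1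
      have hS : S.Nonempty := by
        obtain ⟨b, hb⟩ := h.1
        have hcb : (V.erase b).card = n := by rw [Finset.card_erase_of_mem hb]; omega
        obtain ⟨a, ha⟩ := ih (V.erase b)
          (omm_mono h (Finset.erase_subset _ _) (Finset.card_pos.1 (by omega))) hcb
        have hm := ssvse_mem _ _ _ _ ha
        exact ⟨(a, b), by simp only [S, Finset.mem_filter, Finset.mem_product]
                          exact ⟨⟨Finset.mem_of_mem_erase hm, hb⟩, hm, ha⟩⟩
      have hSV : ∀ p ∈ S, p.1 ∈ V ∧ p.2 ∈ V := by
        intro p hp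
        simp only [S, Finset.mem_filter, Finset.mem_product] at hp
        exact hp.1
      obtain ⟨m, hm, hmax⟩ := exists_max_of_weak succ S hS
        (fun p hp q hq => h.2.1 p q (hSV p hp).1 (hSV p hp).2 (hSV q hq).1 (hSV q hq).2)
        (fun p hp q hq r hr => h.2.2.1 p q r (hSV p hp).1 (hSV p hp).2 (hSV q hq).1 (hSV q hq).2
          (hSV r hr).1 (hSV r hr).2)
      have hm' := hm
      simp only [S, Finset.mem_filter, Finset.mem_product] at hm'
      refine ⟨m.1, Or.inr ⟨hlt, m.2, hm'.1.2, hm'.2.1, hm'.2.2, ?_⟩⟩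
      intro c d hd hc hw
      apply hmax (c, d)
      simp only [S, Finset.mem_filter, Finset.mem_product]
      exact ⟨⟨Finset.mem_of_mem_erase hc, hd⟩, hc, hw⟩

theorem ssvse_sc_aux {X : Type} [DecidableEq X] (succ : X × X → X × X → Prop) (n : ℕ) :
    ∀ V : Finset X, IsOMM V succ → V.card = n → n ≤ 4 →
      ∀ a, SSVSEwinAux succ n V a → SCwinner V succ a := by
  induction n with
  | zero =>
    intro V h hc _ a ha
    exact ha.elim
  | succ n ih =>
    intro V h hc hn a hwin
    have haV := ssvse_mem _ _ _ _ hwin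
    obtain ⟨_, hasym, hneg, hskew⟩ := id h
    rcases hwin with hV | ⟨hlt, b, hbV, hab, hwab, hmax⟩
    · subst hV
      refine ⟨haV, ?_⟩
      intro b hb hd
      rw [Finset.mem_singleton] at hb
      subst hb
      exact hasym _ _ haV haV haV haV hd.2.2.1 hd.2.2.1
    have hcard : ∀ q ∈ V, (V.erase q).card = n := by
      intro q hq
      rw [Finset.card_erase_of_mem hq]; omega
    have homm : ∀ q ∈ V, IsOMM (V.erase q) succ := by
      intro q hq
      refine omm_mono h (Finset.erase_subset _ _) (Finset.card_pos.1 ?_)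
      have := hcard q hq
      omega
    have hne : a ≠ b := Finset.ne_of_mem_erase hab
    refine ⟨haV, ?_⟩
    intro x hxV hd
    by_cases hxb : x ≠ b
    · exact (ih _ (homm b hbV) (hcard b hbV) (by omega) a hwab).2 x
        (Finset.mem_erase.2 ⟨hxb, hxV⟩)
        (scdefeats_anti (Finset.erase_subset _ _) (Finset.mem_erase.2 ⟨hxb, hxV⟩) hab hd)
    push Not at hxb
    subst hxb
    have hba := hd.2.2.1
    -- the edge from `q` to a winner `p` of `V.erase q` is at least as strong as `(x, a)`
    have strong : ∀ q ∈ V, ∃ p ∈ V, p ≠ q ∧ SSVSEwinAux succ n (V.erase q) p ∧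
        ¬ succ (x, a) (q, p) ∧ succ (q, p) (p, q) := by
      intro q hq
      obtain ⟨p, hp⟩ := ssvse_exists succ n _ (homm q hq) (hcard q hq)
      have hpm := ssvse_mem _ _ _ _ hp
      have hpV := Finset.mem_of_mem_erase hpm
      have h1 := hmax p q hq hpm hp
      have h2 : ¬ succ (x, a) (q, p) := fun h' => h1 ((hskew p q a x hpV hq haV hxV).2 h')
      refine ⟨p, hpV, Finset.ne_of_mem_erase hpm, hp, h2, ?_⟩
      by_contra h3
      exact hneg (x, a) (p, q) (a, x) hxV haV hpV hq haV hxV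
        (hneg (x, a) (q, p) (p, q) hxV haV hq hpV hpV hq h2 h3) h1 hba
    have irr : ¬ succ (x, a) (x, a) := fun h' => hasym _ _ hxV haV hxV haV h' h'
    obtain ⟨p, hpV, hpa, hpw, hp1, hp2⟩ := strong a haV
    have hpx : p ≠ x := by
      rintro rfl
      exact hasym _ _ haV hxV hxV haV hp2 hba
    obtain ⟨q, hqV, hqp, hqw, hq1, hq2⟩ := strong p hpV
    have hqa : q ≠ a := by
      rintro rfl
      exact hasym _ _ haV hpV hpV haV hp2 hq2
    by_cases hqx : q = x
    · subst hqx
      refine hd.2.2.2 ⟨[a, p, q], ?_, ?_, ?_, ?_, ?_⟩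
      · simp [hpa.symm, hqp.symm, hqa.symm]
      · simp [haV, hpV, hqV]
      · simp [hp2, hq2, hba]
      · simp
      · simp [hp1, hq1, irr]
    obtain ⟨r, hrV, hrq, hrw, hr1, hr2⟩ := strong q hqV
    have hrp : r ≠ p := by
      rintro rfl
      exact hasym _ _ hrV hqV hqV hrV hq2 hr2
    by_cases hrx : r = x
    · subst hrx
      refine hd.2.2.2 ⟨[a, p, q, r], ?_, ?_, ?_, ?_, ?_⟩
      · simp [hpa.symm, hqp.symm, hqa.symm, hrq.symm, hrp.symm, hne]
      · simp [haV, hpV, hqV, hrV]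
      · simp [hp2, hq2, hr2, hba]
      · simp
      · simp [hp1, hq1, hr1, irr]
    by_cases hra : r = a
    · subst hra
      have hxq : x ∈ V.erase q := Finset.mem_erase.2 ⟨fun h' => hqx h'.symm, hxV⟩
      exact (ih _ (homm q hqV) (hcard q hqV) (by omega) r hrw).2 x hxq
        (scdefeats_anti (Finset.erase_subset _ _) hxq
          (Finset.mem_erase.2 ⟨hqa.symm, haV⟩) hd)
    have hsub : ({a, x, p, q, r} : Finset X) ⊆ V := by
      intro y hy
      simp only [Finset.mem_insert, Finset.mem_singleton] at hy
      rcases hy with rfl | rfl | rfl | rfl | rfl <;> assumption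
    have h5 : ({a, x, p, q, r} : Finset X).card = 5 := by
      have e1 : x ≠ q := fun h' => hqx h'.symm
      have e2 : x ≠ r := fun h' => hrx h'.symm
      have e3 : a ≠ r := fun h' => hra h'.symm
      rw [Finset.card_insert_of_notMem, Finset.card_insert_of_notMem,
        Finset.card_insert_of_notMem, Finset.card_insert_of_notMem, Finset.card_singleton]
      · simp [hrq.symm]
      · simp [hqp.symm, hrp.symm]
      · simp [hpx.symm, e1, e2]
      · simp [hne, hpa.symm, hqa.symm, e3]
    have := Finset.card_le_card hsub
    omega

theorem ssvse_refines_sc_up_to_four {X : Type} [DecidableEq X] (V : Finset X)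
    (succ : X × X → X × X → Prop) (h : IsOMM V succ) (hcard : V.card ≤ 4) :
    ∀ a, SSVSEwin V succ a → SCwinner V succ a := by
  intro a ha
  exact ssvse_sc_aux succ V.card V h rfl hcard a ha
end

section
/- There exists an ordinal margin matrix with 5 alternatives in which some SSV-SE winner is not a Split Cycle winner. -/
variable {X : Type} [DecidableEq X]

/-- The margin table of the counterexample. -/
def cexMargin : Fin 5 → Fin 5 → ℤ :=
  ![![0, 1, 4, 3, -4], ![-1, 0, -1, 2, 0], ![-4, 1, 0, 0, 2], ![-3, -2, 0, 0, 3],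
    ![4, 0, -2, -3, 0]]

/-- The ordinal comparison of pairs induced by the margins. -/
def cexSucc (p q : Fin 5 × Fin 5) : Prop := cexMargin q.1 q.2 < cexMargin p.1 p.2

instance cexSuccDec (p q : Fin 5 × Fin 5) : Decidable (cexSucc p q) :=
  inferInstanceAs (Decidable (cexMargin q.1 q.2 < cexMargin p.1 p.2))

instance cexAuxDec : (n : ℕ) → (V : Finset (Fin 5)) → (a : Fin 5) →
    Decidable (SSVSEwinAux cexSucc n V a)
  | 0, _, _ => isFalse id
  | n + 1, V, a =>
    have : ∀ W c, Decidable (SSVSEwinAux cexSucc n W c) := cexAuxDec n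
    inferInstanceAs (Decidable (V = {a} ∨
        (1 < V.card ∧ ∃ b ∈ V, a ∈ V.erase b ∧ SSVSEwinAux cexSucc n (V.erase b) a ∧
          ∀ c d : Fin 5, d ∈ V → c ∈ V.erase d → SSVSEwinAux cexSucc n (V.erase d) c →
            ¬ cexSucc (c, d) (a, b))))

lemma cexMargin_skew : ∀ a b : Fin 5, cexMargin a b = - cexMargin b a := by decide

lemma cexMargin_into_one : ∀ x : Fin 5, cexMargin x 1 < cexMargin 1 3 := by decide

lemma cexWin : SSVSEwinAux cexSucc 5 Finset.univ 3 := by decide +kernel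

/-- There exists an ordinal margin matrix with 5 alternatives in which some
SSV-SE winner is not a Split Cycle winner. -/
theorem ssvse_not_sc_counterexample_five :
    ∃ succ : Fin 5 × Fin 5 → Fin 5 × Fin 5 → Prop,
      IsOMM (Finset.univ : Finset (Fin 5)) succ ∧
      ∃ a, SSVSEwin Finset.univ succ a ∧ ¬ SCwinner Finset.univ succ a := by
  refine ⟨cexSucc, ⟨⟨0, Finset.mem_univ _⟩, ?_, ?_, ?_⟩, 3, cexWin, ?_⟩
  · intro p q _ _ _ _ h
    exact not_lt.mpr (le_of_lt h)
  · intro p q r _ _ _ _ _ _ h1 h2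
    unfold cexSucc at *
    omega
  · intro a b c d _ _ _ _
    have h1 := cexMargin_skew a b
    have h2 := cexMargin_skew c d
    simp only [cexSucc]
    omega
  · rintro ⟨_, h⟩
    refine h 1 (Finset.mem_univ _) ⟨Finset.mem_univ _, Finset.mem_univ _, ?_, ?_⟩
    · show cexMargin 3 1 < cexMargin 1 3
      decide
    · rintro ⟨l, _, _, _, hmem, hweak⟩
      have h1 : (1 : Fin 5) ∈ l.rotate 1 := List.mem_rotate.mpr (List.of_mem_zip hmem).1
      obtain ⟨i, hi, hi1⟩ := List.getElem_of_mem h1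
      have hil : i < l.length := by simpa using hi
      have hz : (l[i], (1 : Fin 5)) ∈ l.zip (l.rotate 1) := by
        rw [← hi1, List.mem_iff_getElem]
        exact ⟨i, by simpa using hil, by simp [List.getElem_zip]⟩
      exact hweak _ hz (cexMargin_into_one _)
end

section
/- For any ordinal margin matrix M and any linearization M' of M, every Split Cycle winner of M' is a Split Cycle winner of M. -/
variable {X : Type} [DecidableEq X]

/-- For any ordinal margin matrix `M` and any linearization `M'` of `M`,
every Split Cycle winner of `M'` is a Split Cycle winner of `M`. -/
theorem sc_winner_of_linearization {X : Type} [DecidableEq X] (V : Finset X)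
    (succ succ' : X × X → X × X → Prop) (h : IsOMM V succ)
    (hlin : IsLinearization V succ succ') :
    ∀ a, SCwinner V succ' a → SCwinner V succ a := by
  rintro a ⟨ha, hw⟩
  refine ⟨ha, fun b hb ⟨_, _, hba, hno⟩ => hw b hb ⟨hb, ha, hlin.2 _ _ hb ha ha hb hba, ?_⟩⟩
  rintro ⟨l, hnd, hV, hmaj, hmem, hweak⟩
  obtain ⟨_, _, hnt, hskew⟩ := h
  have hEV : ∀ e ∈ l.zip (l.rotate 1), e.1 ∈ V ∧ e.2 ∈ V := by
    rintro ⟨x, y⟩ he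
    have h2 := List.of_mem_zip he
    exact ⟨hV _ h2.1, hV _ (List.mem_rotate.1 h2.2)⟩
  have hweak2 : ∀ e ∈ l.zip (l.rotate 1), ¬ succ (b, a) (e.1, e.2) := fun e he hs =>
    hweak e he (hlin.2 _ _ hb ha (hEV e he).1 (hEV e he).2 hs)
  refine hno ⟨l, hnd, hV, fun e he => ?_, hmem, hweak2⟩
  obtain ⟨h1, h2⟩ := hEV e he
  by_contra hn
  have h3 := hnt (b, a) (e.1, e.2) (e.2, e.1) hb ha h1 h2 h2 h1 (hweak2 e he) hn
  have h4 : ¬ succ (e.1, e.2) (a, b) := fun hs => h3 ((hskew _ _ _ _ h1 h2 ha hb).1 hs)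
  exact hnt (b, a) (e.1, e.2) (a, b) hb ha h1 h2 ha hb (hweak2 e he) h4 hba
end

section
/- Let M be an ordinal margin matrix. If for every linearization M' of M the SSV winner of M' is a Split Cycle winner of M', then every SSV-PUT winner of M is a Split Cycle winner of M. -/
variable {X : Type} [DecidableEq X]

/-- If for every linearization `M'` of the ordinal margin matrix `M` the SSV
winner of `M'` is a Split Cycle winner of `M'`, then every SSV-PUT winner of `M` is a Split
Cycle winner of `M`. -/
theorem ssvput_refines_sc_of_ssv_refines_sc {X : Type} [DecidableEq X] (V : Finset X)
    (succ : X × X → X × X → Prop) (h : IsOMM V succ)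
    (H : ∀ succ' : X × X → X × X → Prop, IsLinearization V succ succ' →
      ∀ a, SSVwin V succ' a → SCwinner V succ' a) :
    ∀ a, SSVPUTwin V succ a → SCwinner V succ a := by
  rintro a ⟨s', hl, hw⟩
  obtain ⟨haV, hsc⟩ := H s' hl a hw
  refine ⟨haV, fun b hb hdef => hsc b hb ?_⟩
  obtain ⟨-, -, hba, hno⟩ := hdef
  refine ⟨hb, haV, hl.2 _ _ hb haV haV hb hba, ?_⟩
  rintro ⟨l, hnd, hlV, -, hmem, hweak⟩
  have hw' : ∀ e ∈ l.zip (l.rotate 1), e.1 ∈ V ∧ e.2 ∈ V ∧ ¬ succ (b, a) (e.1, e.2) := by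
    rintro ⟨x, y⟩ he
    have hx : x ∈ V := hlV x (List.of_mem_zip he).1
    have hy : y ∈ V := hlV y (List.mem_rotate.1 (List.of_mem_zip he).2)
    exact ⟨hx, hy, fun hs => hweak _ he (hl.2 _ _ hb haV hx hy hs)⟩
  refine hno ⟨l, hnd, hlV, ?_, hmem, fun e he => (hw' e he).2.2⟩
  rintro ⟨x, y⟩ he
  obtain ⟨hx, hy, hn⟩ := hw' _ he
  obtain ⟨-, -, hneg, hskew⟩ := h
  have h1 : succ (x, y) (a, b) := by
    by_contra hc
    exact hneg (b, a) (x, y) (a, b) hb haV hx hy haV hb hn hc hba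
  have h2 : succ (b, a) (y, x) := (hskew x y a b hx hy haV hb).1 h1
  by_contra hc
  exact hneg (b, a) (x, y) (y, x) hb haV hx hy hy hx hn hc h2
end

section
/- For every ordinal margin matrix M with at most 6 alternatives, every SSV-PUT winner of M is a Split Cycle winner of M. -/
variable {X : Type} [DecidableEq X]

namespace SSVproof

/-- Strict cut form of being undefeated in Split Cycle. -/
def UU (m : X → X → ℤ) (S : Finset X) (x : X) : Prop :=
  ∀ T ⊆ S, x ∈ T → ∀ y ∈ S, y ∉ T → ∃ t ∈ T, ∃ u ∈ S, u ∉ T ∧ m y x < m t u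

structure Base (m : X → X → ℤ) (w : Finset X → X) (V : Finset X) : Prop where
  anti : ∀ x y, m y x = - m x y
  mem : ∀ S ⊆ V, S.Nonempty → w S ∈ S
  spec : ∀ S ⊆ V, 2 ≤ S.card → ∃ y ∈ S, w S ≠ y ∧ w (S.erase y) = w S ∧
    ∀ d ∈ S, m (w (S.erase d)) d ≤ m (w S) y

structure Bad (m : X → X → ℤ) (w : Finset X → X) (V R : Finset X) (a b : X) : Prop
    extends Base m w V where
  und : ∀ S ⊆ V, S ≠ V → S.Nonempty → UU m S (w S)
  sub : R ⊆ V
  ha : a ∈ R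
  hb : b ∈ V
  hbR : b ∉ R
  fb : w (V.erase b) = a
  pos : 0 < m b a
  cross : ∀ r ∈ R, ∀ q ∈ V, q ∉ R → m r q < m b a
  fdown : ∀ d ∈ V, d ≠ b → m b a < m d (w (V.erase d))

section
variable {m : X → X → ℤ} {w : Finset X → X} {V R : Finset X} {a b : X}

theorem Bad.cut (B : Bad m w V R a b) (r : X) (T : Finset X) (y : X) (hr : r ∈ V) (hT : T ⊆ R)
    (hrT : r ∉ T) (hf : w (V.erase r) ∈ T) (hy : y ∈ V) (hyT : y ∉ T) (hyr : y ≠ r)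
    (hmu : m b a ≤ m y (w (V.erase r))) :
    ∃ t ∈ T, ∃ u ∈ R, u ∉ T ∧ u ≠ r ∧ m y (w (V.erase r)) < m t u := by
  have h := B.und (V.erase r) (Finset.erase_subset _ _)
    (by intro h; rw [← h] at hr; simp at hr) ⟨y, by simp [hy, hyr]⟩
  obtain ⟨t, ht, u, hu, huT, hlt⟩ := h T
    (fun z hz => by
      have := B.sub (hT hz)
      have : z ≠ r := by rintro rfl; exact hrT hz
      simp [*]) hf y (by simp [*]) hyT
  simp at hu
  refine ⟨t, ht, u, ?_, huT, hu.1, hlt⟩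
  by_contra hn
  have := B.cross t (hT ht) u hu.2 hn
  omega

theorem Bad.fR (B : Bad m w V R a b) {r : X} (hr : r ∈ R) : w (V.erase r) ∈ R := by
  have hrV := B.sub hr
  have hrb : r ≠ b := by rintro rfl; exact B.hbR hr
  have hm : w (V.erase r) ∈ V.erase r := B.mem _ (Finset.erase_subset _ _)
    ⟨b, by simp [B.hb, hrb.symm]⟩
  by_contra hn
  have := B.cross r hr _ (Finset.mem_of_mem_erase hm) hn
  have := B.fdown r hrV hrb
  omega

/-- members of `V \ R` do not beat `f r` strongly -/
theorem Bad.qf (B : Bad m w V R a b) {r q : X} (hr : r ∈ R) (hq : q ∈ V) (hqR : q ∉ R) :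
    m q (w (V.erase r)) < m b a := by
  by_contra hn
  have hfr := B.fR hr
  have hrb : r ≠ b := by rintro rfl; exact B.hbR hr
  have hm : w (V.erase r) ∈ V.erase r := B.mem _ (Finset.erase_subset _ _)
    ⟨b, by simp [B.hb, hrb.symm]⟩
  obtain ⟨t, ht, u, hu, huT, h1, h2⟩ := B.cut r (R.erase r) q (B.sub hr) (Finset.erase_subset _ _) (by simp)
    (by simp [hfr]; simpa using Finset.ne_of_mem_erase hm) hq (by simp [hqR]) (by rintro rfl; exact hqR hr) (by omega)
  simp at huT
  exact huT h1 hu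

theorem Bad.fne_a (B : Bad m w V R a b) {r : X} (hr : r ∈ R) : w (V.erase r) ≠ a := by
  intro h
  have := B.qf hr B.hb B.hbR
  rw [h] at this; omega

theorem Bad.fpos (B : Bad m w V R a b) {r : X} (hr : r ∈ R) : m b a < m r (w (V.erase r)) :=
  B.fdown r (B.sub hr) (by rintro rfl; exact B.hbR hr)

theorem Bad.fne (B : Bad m w V R a b) {r : X} (hr : r ∈ R) : w (V.erase r) ≠ r := by
  intro h
  have h1 := B.fpos hr
  have := B.pos
  have := B.anti r r
  rw [h] at h1; omega

theorem Bad.f2 (B : Bad m w V R a b) {r s : X} (hr : r ∈ R) (hs : s ∈ R)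
    (h1 : w (V.erase r) = s) (h2 : w (V.erase s) = r) : False := by
  have h3 := B.fpos hr
  have h4 := B.fpos hs
  have := B.pos
  have := B.anti r s
  rw [h1] at h3; rw [h2] at h4; omega

theorem Bad.four (B : Bad m w V R a b) {c1 c2 c3 : X} (hR : R = {a, c1, c2, c3})
    (d1 : a ≠ c1) (d2 : a ≠ c2) (d3 : a ≠ c3) (d4 : c1 ≠ c2) (d5 : c1 ≠ c3) (d6 : c2 ≠ c3)
    (f0 : w (V.erase a) = c1) (f1 : w (V.erase c1) = c2) (f2 : w (V.erase c2) = c3)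
    (f3 : w (V.erase c3) = c1) : False := by
  have ia : a ∈ R := by simp [hR]
  have i1 : c1 ∈ R := by simp [hR]
  have i2 : c2 ∈ R := by simp [hR]
  have i3 : c3 ∈ R := by simp [hR]
  have p0 := B.fpos ia
  have p1 := B.fpos i1
  have p2 := B.fpos i2
  have p3 := B.fpos i3
  rw [f0] at p0; rw [f1] at p1; rw [f2] at p2; rw [f3] at p3
  have hp := B.pos
  have k1 := B.cut c3 {c1, c2} a (B.sub i3) (by simp [hR, Finset.insert_subset_iff])
    (by simp [*, d5.symm, d6.symm]) (by simp [f3]) (B.sub ia) (by simp [*]) d3 (by rw [f3]; omega)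
  have k2 := fun hh => B.cut c2 {c3, c1} a (B.sub i2) (by simp [hR, Finset.insert_subset_iff])
    (by simp [*, d4.symm]) (by simp [f2]) (B.sub ia) (by simp [*]) d2 hh
  have hbn : ∀ r ∈ R, r ≠ b := by rintro r hr rfl; exact B.hbR hr
  have k3 := fun hh => B.cut b {a} c2 B.hb (by simp [hR])
    (by simpa using (hbn a ia).symm) (by simp [B.fb]) (B.sub i2) (by simp [d2.symm]) (hbn c2 i2) hh
  rw [B.fb] at k3
  rw [f3] at k1
  rw [f2] at k2
  have e1 := B.anti a c1
  have e2 := B.anti a c2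
  have e3 := B.anti a c3
  simp [hR, d1, d2, d3, d4, d5, d6, d1.symm, d2.symm, d3.symm, d4.symm, d5.symm, d6.symm, or_and_right, and_or_left, exists_or] at k1 k2 k3
  grind
end

section fin6
variable {m : Fin 6 → Fin 6 → ℤ} {w : Finset (Fin 6) → Fin 6}

/-- the pairs that cross the cut `T` inside `S` -/
def crossing (S T : Finset (Fin 6)) : List (Fin 6 × Fin 6) :=
  ([0, 1, 2, 3, 4, 5].product [0, 1, 2, 3, 4, 5]).filter
    fun p => decide (p.1 ∈ T ∧ p.2 ∈ S ∧ p.2 ∉ T)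

theorem mem_crossing {S T : Finset (Fin 6)} {t u : Fin 6} (ht : t ∈ T) (hu : u ∈ S) (hu' : u ∉ T) :
    (t, u) ∈ crossing S T := by
  simp only [crossing, List.mem_filter, decide_eq_true_eq]
  refine ⟨?_, ht, hu, hu'⟩
  clear ht hu hu'
  revert t u
  decide

theorem Bad.cut6 (B : Bad m w Finset.univ (Finset.univ.erase 5) 0 5) (r : Fin 6)
    (T : Finset (Fin 6)) (y x : Fin 6) (hx : w (Finset.univ.erase r) = x)
    (hs : r ∉ T ∧ 5 ∉ T ∧ x ∈ T ∧ y ∉ T ∧ y ≠ r) :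
    m y x < m 5 0 ∨ ∃ p ∈ crossing ((Finset.univ.erase 5).erase r) T, m y x < m p.1 p.2 := by
  by_cases h : m y x < m 5 0
  · exact Or.inl h
  right
  obtain ⟨h1, h2, h3, h4, h5⟩ := hs
  obtain ⟨t, ht, u, hu, hu1, hu2, hlt⟩ := B.cut r T y (by simp)
    (by intro z hz; simp; rintro rfl; exact h2 hz) h1 (by rw [hx]; exact h3) (by simp) h4 h5
    (by rw [hx]; omega)
  refine ⟨(t, u), mem_crossing ht (by simp [hu2]; simpa using hu) hu1, by rw [hx] at hlt; exact hlt⟩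

theorem Bad.cutS (B : Bad m w Finset.univ (Finset.univ.erase 5) 0 5) {S : Finset (Fin 6)} {x : Fin 6}
    (hx : w S = x) (T : Finset (Fin 6)) (y : Fin 6)
    (hs : S ≠ Finset.univ ∧ T ⊆ S ∧ x ∈ T ∧ y ∈ S ∧ y ∉ T) :
    ∃ p ∈ crossing S T, m y x < m p.1 p.2 := by
  obtain ⟨h0, h1, h2, h3, h4⟩ := hs
  subst hx
  obtain ⟨t, ht, u, hu, hu1, hlt⟩ := B.und S (Finset.subset_univ _) h0 ⟨y, h3⟩ T h1 h2 y h3 h4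
  exact ⟨(t, u), mem_crossing ht hu hu1, hlt⟩

theorem Bad.antis (B : Bad m w Finset.univ (Finset.univ.erase 5) 0 5) :
    m 1 0 = - m 0 1 ∧ m 2 0 = - m 0 2 ∧ m 3 0 = - m 0 3 ∧ m 4 0 = - m 0 4 ∧ m 5 0 = - m 0 5 ∧
    m 2 1 = - m 1 2 ∧ m 3 1 = - m 1 3 ∧ m 4 1 = - m 1 4 ∧ m 5 1 = - m 1 5 ∧
    m 3 2 = - m 2 3 ∧ m 4 2 = - m 2 4 ∧ m 5 2 = - m 2 5 ∧
    m 4 3 = - m 3 4 ∧ m 5 3 = - m 3 5 ∧ m 5 4 = - m 4 5 := by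
  refine ⟨?_, ?_, ?_, ?_, ?_, ?_, ?_, ?_, ?_, ?_, ?_, ?_, ?_, ?_, ?_⟩ <;> exact B.anti _ _

theorem Bad.t13 (B : Bad m w Finset.univ (Finset.univ.erase 5) 0 5)
    (f0 : w (Finset.univ.erase 0) = 1) (f1 : w (Finset.univ.erase 1) = 2)
    (f2 : w (Finset.univ.erase 2) = 3) (f3 : w (Finset.univ.erase 3) = 1)
    (f4 : w (Finset.univ.erase 4) = 3) : False := by
  have hp := B.pos
  have p0 := B.fpos (r := 0) (by decide)
  have p1 := B.fpos (r := 1) (by decide)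
  have p2 := B.fpos (r := 2) (by decide)
  have p3 := B.fpos (r := 3) (by decide)
  have p4 := B.fpos (r := 4) (by decide)
  rw [f0] at p0; rw [f1] at p1; rw [f2] at p2; rw [f3] at p3; rw [f4] at p4
  have an := B.antis
  have k1 := B.cut6 0 {1, 2, 4} 3 1 f0 (by decide)
  have k2 := B.cut6 2 {3} 4 3 f2 (by decide)
  have k3 := B.cut6 4 {3} 2 3 f4 (by decide)
  have k4 := B.cut6 5 {0, 1, 2, 4} 3 0 B.fb (by decide)
  simp [crossing, List.product] at k1 k2 k3 k4
  grind (splits := 60)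

theorem Bad.t42 (B : Bad m w Finset.univ (Finset.univ.erase 5) 0 5)
    (f0 : w (Finset.univ.erase 0) = 1) (f1 : w (Finset.univ.erase 1) = 2)
    (f2 : w (Finset.univ.erase 2) = 3) (f3 : w (Finset.univ.erase 3) = 4)
    (f4 : w (Finset.univ.erase 4) = 2) : False := by
  have hp := B.pos
  have p0 := B.fpos (r := 0) (by decide)
  have p1 := B.fpos (r := 1) (by decide)
  have p2 := B.fpos (r := 2) (by decide)
  have p3 := B.fpos (r := 3) (by decide)
  have p4 := B.fpos (r := 4) (by decide)
  rw [f0] at p0; rw [f1] at p1; rw [f2] at p2; rw [f3] at p3; rw [f4] at p4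
  have an := B.antis
  have k1 := B.cut6 0 {1} 3 1 f0 (by decide)
  have k2 := B.cut6 0 {1} 4 1 f0 (by decide)
  have k3 := B.cut6 2 {3, 1, 4} 0 3 f2 (by decide)
  have k4 := B.cut6 2 {3, 4} 1 3 f2 (by decide)
  have k5 := B.cut6 3 {4, 1, 2} 0 4 f3 (by decide)
  have k6 := B.cut6 3 {4, 2} 1 4 f3 (by decide)
  have k7 := B.cut6 4 {2, 1, 3} 0 2 f4 (by decide)
  have k8 := B.cut6 4 {2, 3} 1 2 f4 (by decide)
  have k9 := B.cut6 5 {0, 1} 2 0 B.fb (by decide)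
  have k10 := B.cut6 5 {0, 1} 3 0 B.fb (by decide)
  have k11 := B.cut6 5 {0, 1} 4 0 B.fb (by decide)
  simp [crossing, List.product] at k1 k2 k3 k4 k5 k6 k7 k8 k9 k10 k11
  obtain ⟨M, hM1, hM2, hM3, hM4, hM⟩ : ∃ M : ℤ, m 5 0 ≤ M ∧ m 2 0 ≤ M ∧ m 3 0 ≤ M ∧ m 4 0 ≤ M ∧
      (M = m 5 0 ∨ M = m 2 0 ∨ M = m 3 0 ∨ M = m 4 0) :=
    ⟨max (m 5 0) (max (m 2 0) (max (m 3 0) (m 4 0))), by omega, by omega, by omega, by omega, by omega⟩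
  obtain ⟨a1, a2, a3, a4, a5, a6, a7, a8, a9, a10, a11, a12, a13, a14, a15⟩ := an
  have q14 : m 1 4 ≤ M := by clear k1 k2 k3 k4 k5 k7 k8 k9 k10 k11 hM; omega
  have q12 : m 1 2 ≤ M := by clear k3 k4 k5 k6 k7 k9 k10 k11 hM; omega
  have q13 : m 1 3 ≤ M := by clear k3 k5 k6 k7 k9 k10 k11 hM; omega
  have q02 : m 0 2 ≤ M := by clear k1 k2 k3 k4 k5 k6 k8 k9 k10 k11 hM; omega
  have q03 : m 0 3 ≤ M := by clear k1 k2 k4 k5 k6 k7 k8 k9 k10 k11 hM; omega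
  have q04 : m 0 4 ≤ M := by clear k1 k2 k3 k4 k6 k7 k8 k9 k10 k11 hM; omega
  clear k1 k2 k3 k4 k5 k6 k7 k8
  omega

theorem Bad.t41 (B : Bad m w Finset.univ (Finset.univ.erase 5) 0 5)
    (f0 : w (Finset.univ.erase 0) = 1) (f1 : w (Finset.univ.erase 1) = 2)
    (f2 : w (Finset.univ.erase 2) = 3) (f3 : w (Finset.univ.erase 3) = 4)
    (f4 : w (Finset.univ.erase 4) = 1) : False := by
  have hp := B.pos
  have p0 := B.fpos (r := 0) (by decide)
  rw [f0] at p0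
  have an := B.antis
  have k1 := B.cut6 1 {2, 3, 4} 0 2 f1 (by decide)
  have k2 := B.cut6 2 {3, 1, 4} 0 3 f2 (by decide)
  have k3 := B.cut6 3 {4, 1, 2} 0 4 f3 (by decide)
  have k4 := B.cut6 4 {1, 2, 3} 0 1 f4 (by decide)
  have k5 := B.cut6 5 {0} 2 0 B.fb (by decide)
  have k6 := B.cut6 5 {0} 3 0 B.fb (by decide)
  have k7 := B.cut6 5 {0} 4 0 B.fb (by decide)
  simp [crossing, List.product] at k1 k2 k3 k4 k5 k6 k7
  grind (splits := 60)

theorem Bad.facts1 (B : Bad m w Finset.univ (Finset.univ.erase 5) 0 5)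
    (f0 : w (Finset.univ.erase 0) = 1) (f1 : w (Finset.univ.erase 1) = 2)
    (f2 : w (Finset.univ.erase 2) = 3) (f3 : w (Finset.univ.erase 3) = 1)
    (f4 : w (Finset.univ.erase 4) = 1) :
    0 < m 0 4 ∧ m 2 0 < m 0 4 ∧ m 0 1 < m 2 0 ∧ m 0 1 < m 1 2 ∧ m 0 3 < m 5 0 ∧
      (m 4 1 ≤ m 2 0 → m 2 0 < m 4 2) := by
  have hp := B.pos
  have p0 := B.fpos (r := 0) (by decide)
  have p1 := B.fpos (r := 1) (by decide)
  have p2 := B.fpos (r := 2) (by decide)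
  have p3 := B.fpos (r := 3) (by decide)
  have p4 := B.fpos (r := 4) (by decide)
  rw [f0] at p0; rw [f1] at p1; rw [f2] at p2; rw [f3] at p3; rw [f4] at p4
  have an := B.antis
  have k1 := B.cut6 1 {2, 3, 4} 0 2 f1 (by decide)
  have k2 := B.cut6 2 {3, 1, 4} 0 3 f2 (by decide)
  have k3 := B.cut6 3 {1, 2, 4} 0 1 f3 (by decide)
  have k4 := B.cut6 5 {0} 2 0 B.fb (by decide)
  have k5 := B.cut6 5 {0} 3 0 B.fb (by decide)
  have k6 := B.cut6 5 {0} 4 0 B.fb (by decide)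
  have k7 := B.cut6 3 {1} 0 1 f3 (by decide)
  have k8 := B.cut6 4 {1, 2, 3} 0 1 f4 (by decide)
  have k9 := B.cut6 2 {3, 1} 4 3 f2 (by decide)
  have k10 := B.cut6 5 {0, 4} 2 0 B.fb (by decide)
  have k11 := B.cut6 5 {0, 4} 3 0 B.fb (by decide)
  simp [crossing, List.product] at k1 k2 k3 k4 k5 k6 k7 k8 k9 k10 k11
  have g1 : 0 < m 0 4 := by clear k7 k8 k9 k10 k11; grind (splits := 60)
  have g2 : m 2 0 < m 0 4 := by clear k7 k8 k9 k10 k11; grind (splits := 60)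
  have g3 : m 0 1 < m 2 0 := by clear k7 k8 k9 k10 k11; grind (splits := 60)
  have g4 : m 0 1 < m 1 2 := by clear k8 k9 k10 k11; grind (splits := 60)
  have g5 : m 0 3 < m 5 0 := by clear k7 k9 k10 k11; grind (splits := 60)
  refine ⟨g1, g2, g3, g4, g5, ?_⟩
  clear k7 k8; grind (splits := 60)

theorem Bad.facts2 (B : Bad m w Finset.univ (Finset.univ.erase 5) 0 5)
    (f0 : w (Finset.univ.erase 0) = 1) (f1 : w (Finset.univ.erase 1) = 2)
    (f2 : w (Finset.univ.erase 2) = 3) (f3 : w (Finset.univ.erase 3) = 1)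
    (f4 : w (Finset.univ.erase 4) = 2) :
    0 < m 0 4 ∧ m 2 0 < m 0 4 ∧ m 0 1 < m 2 0 ∧ m 0 3 < m 5 0 ∧ m 0 1 < m 1 4 ∧ m 3 1 < m 1 4 ∧
      m 2 0 < m 4 2 ∧ m 4 2 < m 3 4 ∧ m 4 2 < m 2 3 := by
  have hp := B.pos
  have p0 := B.fpos (r := 0) (by decide)
  have p1 := B.fpos (r := 1) (by decide)
  have p2 := B.fpos (r := 2) (by decide)
  have p3 := B.fpos (r := 3) (by decide)
  have p4 := B.fpos (r := 4) (by decide)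
  rw [f0] at p0; rw [f1] at p1; rw [f2] at p2; rw [f3] at p3; rw [f4] at p4
  have an := B.antis
  have k1 := B.cut6 2 {3, 1, 4} 0 3 f2 (by decide)
  have k2 := B.cut6 3 {1, 2, 4} 0 1 f3 (by decide)
  have k3 := B.cut6 4 {2, 1, 3} 0 2 f4 (by decide)
  have k4 := B.cut6 5 {0} 2 0 B.fb (by decide)
  have k5 := B.cut6 5 {0} 3 0 B.fb (by decide)
  have k6 := B.cut6 5 {0} 4 0 B.fb (by decide)
  have k7 := B.cut6 1 {2, 3, 4} 0 2 f1 (by decide)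
  have j1 := B.cut6 0 {1} 3 1 f0 (by decide)
  have j2 := B.cut6 3 {1} 0 1 f3 (by decide)
  have j3 := B.cut6 4 {2, 0, 3} 1 2 f4 (by decide)
  have i1 := B.cut6 0 {1, 4} 3 1 f0 (by decide)
  have i2 := B.cut6 2 {3} 4 3 f2 (by decide)
  have i3 := B.cut6 4 {2, 3} 1 2 f4 (by decide)
  have i4 := B.cut6 5 {0, 1, 3, 4} 2 0 B.fb (by decide)
  have i5 := B.cut6 5 {0, 1, 4} 3 0 B.fb (by decide)
  have i6 := B.cut6 1 {2, 3} 0 2 f1 (by decide)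
  have i7 := B.cut6 1 {2, 3} 4 2 f1 (by decide)
  have h1 := B.cut6 1 {2} 4 2 f1 (by decide)
  have h2 := B.cut6 4 {2} 1 2 f4 (by decide)
  simp [crossing, List.product] at k1 k2 k3 k4 k5 k6 k7 j1 j2 j3 i1 i2 i3 i4 i5 i6 i7 h1 h2
  have g1 : 0 < m 0 4 := by clear k7 j1 j2 j3 i1 i2 i3 i4 i5 i6 i7 h1 h2; grind (splits := 60)
  have g2 : m 2 0 < m 0 4 := by clear k7 j1 j2 j3 i1 i2 i3 i4 i5 i6 i7 h1 h2; grind (splits := 60)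
  have g3 : m 0 1 < m 2 0 := by clear k7 j1 j2 j3 i1 i2 i3 i4 i5 i6 i7 h1 h2; grind (splits := 60)
  have g4 : m 0 3 < m 5 0 := by clear j1 j2 j3 i1 i2 i3 i4 i5 i6 i7 h1 h2; grind (splits := 60)
  have g5 : m 0 1 < m 1 4 := by clear k1 k2 k3 k4 k5 k6 k7 i1 i2 i3 i4 i5 i6 i7 h1 h2; grind (splits := 60)
  have g6 : m 3 1 < m 1 4 := by clear k1 k2 k3 k4 k5 k6 k7 i1 i2 i3 i4 i5 i6 i7 h1 h2; grind (splits := 60)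
  have g7 : m 2 0 < m 4 2 := by clear k1 k2 k3 k4 k5 k6 k7 j1 j2 j3 i6 i7 h1 h2; grind (splits := 60)
  have g8 : m 4 2 < m 3 4 := by clear k1 k2 k3 k4 k5 k6 k7 j1 j2 j3 h1 h2; grind (splits := 60)
  have g9 : m 4 2 < m 2 3 := by
    clear k1 k2 k3 k4 k5 k6 k7 j1 j2 j3 i1 i2 i3 i5 i6 i7; grind (splits := 60)
  exact ⟨g1, g2, g3, g4, g5, g6, g7, g8, g9⟩
theorem Bad.win3a (B : Bad m w Finset.univ (Finset.univ.erase 5) 0 5) (x y z : Fin 6)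
    (h1 : 0 < m x y) (h2 : 0 < m x z) (hd : x ≠ y ∧ x ≠ z ∧ y ≠ z) : w {x, y, z} = x := by
  obtain ⟨d1, d2, d3⟩ := hd
  have hS : ({x, y, z} : Finset (Fin 6)) ≠ Finset.univ := by
    intro h
    have := congrArg Finset.card h
    have h3 := Finset.card_le_three (a := x) (b := y) (c := z)
    simp only [Finset.card_univ, Fintype.card_fin] at this
    omega
  have hm := B.mem {x, y, z} (Finset.subset_univ _) ⟨x, by simp⟩
  have hu := B.und {x, y, z} (Finset.subset_univ _) hS ⟨x, by simp⟩
  have e1 := B.anti x y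
  have e2 := B.anti x z
  have e3 := B.anti y z
  by_contra hne
  have hu' := hu {y, z} (by simp) (by simp at hm ⊢; tauto) x (by simp) (by simp [d1, d2])
  have hx : 0 < m x (w {x, y, z}) := by
    simp at hm
    rcases hm with h | h | h
    · exact absurd h hne
    · rw [h]; exact h1
    · rw [h]; exact h2
  simp [d1.symm, d2.symm, d3.symm] at hu'
  omega

theorem Bad.win3b (B : Bad m w Finset.univ (Finset.univ.erase 5) 0 5) (x y z : Fin 6)
    (h1 : 0 < m y x) (h2 : m y x < m x z) (h3 : m y x < m z y)
    (hd : x ≠ y ∧ x ≠ z ∧ y ≠ z) : w {x, y, z} = x := by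
  obtain ⟨d1, d2, d3⟩ := hd
  have hS : ({x, y, z} : Finset (Fin 6)) ≠ Finset.univ := by
    intro h
    have := congrArg Finset.card h
    have h3 := Finset.card_le_three (a := x) (b := y) (c := z)
    simp only [Finset.card_univ, Fintype.card_fin] at this
    omega
  have hm := B.mem {x, y, z} (Finset.subset_univ _) ⟨x, by simp⟩
  have hu := B.und {x, y, z} (Finset.subset_univ _) hS ⟨x, by simp⟩
  have e1 := B.anti x y
  have e2 := B.anti x z
  have e3 := B.anti y z
  simp only [Finset.mem_insert, Finset.mem_singleton] at hm
  rcases hm with h | h | h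
  · exact h
  · rw [h] at hu
    have := hu {y} (by simp) (by simp) z (by simp) (by simp [d3.symm])
    simp [d1, d3.symm] at this
    omega
  · rw [h] at hu
    have := hu {y, z} (by simp) (by simp) x (by simp) (by simp [d1, d2])
    simp [d1.symm, d2.symm, d3.symm] at this
    omega

theorem Bad.spec6 (B : Bad m w Finset.univ (Finset.univ.erase 5) 0 5) {S : Finset (Fin 6)}
    {x : Fin 6} (hx : w S = x) (hS : 2 ≤ S.card) :
    ∃ y ∈ S, x ≠ y ∧ w (S.erase y) = x ∧ ∀ d ∈ S, m (w (S.erase d)) d ≤ m x y := by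
  subst hx
  exact B.spec S (Finset.subset_univ _) hS

theorem Bad.common1 (B : Bad m w Finset.univ (Finset.univ.erase 5) 0 5)
    (f0 : w (Finset.univ.erase 0) = 1) (f1 : w (Finset.univ.erase 1) = 2)
    (f3 : w (Finset.univ.erase 3) = 1)
    (g1 : 0 < m 0 4) (g2 : m 2 0 < m 0 4) (g3 : m 0 1 < m 2 0) :
    w {0, 1, 2, 4} = 1 ∨ (w {0, 1, 2, 5} = 1 ∧ - m 5 0 ≤ m 1 4) := by
  have hp := B.pos
  have p0 := B.fpos (r := 0) (by decide)
  rw [f0] at p0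
  obtain ⟨a1, a2, a3, a4, a5, a6, a7, a8, a9, a10, a11, a12, a13, a14, a15⟩ := B.antis
  have q1 : m 5 1 < m 5 0 := by
    have := B.qf (r := 0) (q := 5) (by decide) (by decide) (by decide)
    rwa [f0] at this
  have q2 : m 5 2 < m 5 0 := by
    have := B.qf (r := 1) (q := 5) (by decide) (by decide) (by decide)
    rwa [f1] at this
  obtain ⟨y, hy, hne, hw, hc⟩ := B.spec6 f3 (by decide)
  have key : - m 5 0 ≤ m 1 y := by
    have h5 := hc 5 (by decide)
    have e : ((Finset.univ.erase 3).erase 5 : Finset (Fin 6)) = {0, 1, 2, 4} := by decide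
    rw [e] at h5
    have hm := B.mem {0, 1, 2, 4} (Finset.subset_univ _) ⟨0, by simp⟩
    by_contra hcon
    simp only [Finset.mem_insert, Finset.mem_singleton] at hm
    rcases hm with h | h | h | h
    · rw [h] at h5; omega
    · rw [h] at h5; omega
    · rw [h] at h5; omega
    · have k := B.cutS h {4, 1, 2} 0 (by decide)
      simp [crossing, List.product] at k
      omega
  have hy' : y = 0 ∨ y = 1 ∨ y = 2 ∨ y = 3 ∨ y = 4 ∨ y = 5 := by
    clear hne hw hc key; revert hy; revert y; decide
  rcases hy' with rfl | rfl | rfl | rfl | rfl | rfl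
  · omega
  · exact absurd rfl hne
  · have e : ((Finset.univ.erase 3).erase 2 : Finset (Fin 6)) = {0, 1, 4, 5} := by decide
    rw [e] at hw
    have k := B.cutS hw {1, 4, 5} 0 (by decide)
    simp [crossing, List.product] at k
    omega
  · exact absurd hy (by decide)
  · have e : ((Finset.univ.erase 3).erase 4 : Finset (Fin 6)) = {0, 1, 2, 5} := by decide
    rw [e] at hw
    exact Or.inr ⟨hw, key⟩
  · have e : ((Finset.univ.erase 3).erase 5 : Finset (Fin 6)) = {0, 1, 2, 4} := by decide
    rw [e] at hw
    exact Or.inl hw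

theorem Bad.common2 (B : Bad m w Finset.univ (Finset.univ.erase 5) 0 5)
    (f0 : w (Finset.univ.erase 0) = 1)
    (g3 : m 0 1 < m 2 0) (g5 : m 0 3 < m 5 0) :
    w {0, 2, 3, 4} = 0 ∨ (w {0, 1, 3, 4} = 0 ∧ w {1, 2, 3, 4} = 4) ∨ w {0, 1, 2, 4} = 0 := by
  have hp := B.pos
  have p0 := B.fpos (r := 0) (by decide)
  rw [f0] at p0
  obtain ⟨a1, a2, a3, a4, a5, a6, a7, a8, a9, a10, a11, a12, a13, a14, a15⟩ := B.antis
  obtain ⟨y, hy, hne, hw, hc⟩ := B.spec6 B.fb (by decide)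
  have hy' : y = 0 ∨ y = 1 ∨ y = 2 ∨ y = 3 ∨ y = 4 ∨ y = 5 := by
    clear hne hw hc; revert hy; revert y; decide
  rcases hy' with rfl | rfl | rfl | rfl | rfl | rfl
  · exact absurd rfl hne
  · have e : ((Finset.univ.erase 5).erase 1 : Finset (Fin 6)) = {0, 2, 3, 4} := by decide
    rw [e] at hw
    exact Or.inl hw
  · have e : ((Finset.univ.erase 5).erase 2 : Finset (Fin 6)) = {0, 1, 3, 4} := by decide
    rw [e] at hw
    refine Or.inr (Or.inl ⟨hw, ?_⟩)
    have h5 := hc 0 (by decide)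
    have e : ((Finset.univ.erase 5).erase 0 : Finset (Fin 6)) = {1, 2, 3, 4} := by decide
    rw [e] at h5
    have hm := B.mem {1, 2, 3, 4} (Finset.subset_univ _) ⟨1, by simp⟩
    simp only [Finset.mem_insert, Finset.mem_singleton] at hm
    rcases hm with h | h | h | h
    · rw [h] at h5; omega
    · rw [h] at h5; omega
    · rw [h] at h5; omega
    · exact h
  · have e : ((Finset.univ.erase 5).erase 3 : Finset (Fin 6)) = {0, 1, 2, 4} := by decide
    rw [e] at hw
    exact Or.inr (Or.inr hw)
  · have e : ((Finset.univ.erase 5).erase 4 : Finset (Fin 6)) = {0, 1, 2, 3} := by decide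
    rw [e] at hw
    have k := B.cutS hw {0} 2 (by decide)
    simp [crossing, List.product] at k
    omega
  · exact absurd hy (by decide)

theorem Bad.type1 (B : Bad m w Finset.univ (Finset.univ.erase 5) 0 5)
    (f0 : w (Finset.univ.erase 0) = 1) (f1 : w (Finset.univ.erase 1) = 2)
    (f2 : w (Finset.univ.erase 2) = 3) (f3 : w (Finset.univ.erase 3) = 1)
    (f4 : w (Finset.univ.erase 4) = 1) : False := by
  obtain ⟨g1, g2, g3, g4, g5, g6⟩ := B.facts1 f0 f1 f2 f3 f4
  have hp := B.pos
  have p0 := B.fpos (r := 0) (by decide)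
  have p4 := B.fpos (r := 4) (by decide)
  rw [f0] at p0; rw [f4] at p4
  have k0 := B.cut6 2 {3, 1} 4 3 f2 (by decide)
  simp [crossing, List.product] at k0
  obtain ⟨a1, a2, a3, a4, a5, a6, a7, a8, a9, a10, a11, a12, a13, a14, a15⟩ := B.antis
  have hw : w {0, 1, 2, 4} = 1 := by
    rcases B.common1 f0 f1 f3 g1 g2 g3 with h | ⟨_, h⟩
    · exact h
    · omega
  have e0 : ({0, 1, 2, 4} : Finset (Fin 6)).erase 0 = {1, 2, 4} := by decide
  have e1 : ({0, 1, 2, 4} : Finset (Fin 6)).erase 1 = {0, 4, 2} := by decide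
  have e2 : ({0, 1, 2, 4} : Finset (Fin 6)).erase 2 = {0, 1, 4} := by decide
  have e4 : ({0, 1, 2, 4} : Finset (Fin 6)).erase 4 = {1, 0, 2} := by decide
  have w2 : w {0, 1, 4} = 0 := B.win3a 0 1 4 (by omega) (by omega) (by decide)
  have w4 : w {1, 0, 2} = 1 := B.win3b 1 0 2 (by omega) (by omega) (by omega) (by decide)
  obtain ⟨z, hz, hne, hwz, hc⟩ := B.spec6 hw (by decide)
  have c2 := hc 2 (by decide)
  rw [e2, w2] at c2
  have c4 := hc 4 (by decide)
  rw [e4, w4] at c4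
  have c1 := hc 1 (by decide)
  rw [e1] at c1
  have hz' : z = 0 ∨ z = 1 ∨ z = 2 ∨ z = 4 := by simpa using hz
  rcases hz' with rfl | rfl | rfl | rfl
  · rw [e0] at hwz
    have k1 := B.cutS hwz {1} 4 (by decide)
    have k2 := B.cutS hwz {1, 2} 4 (by decide)
    simp [crossing, List.product] at k1 k2
    rcases B.common2 f0 g3 g5 with h | ⟨h, h'⟩ | h
    · have k3 := B.cutS h {0, 3, 4} 2 (by decide)
      have p2 := B.fpos (r := 2) (by decide)
      rw [f2] at p2
      simp [crossing, List.product] at k3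
      omega
    · have k3 := B.cutS h {0, 1, 4} 3 (by decide)
      have k4 := B.cutS h' {4} 2 (by decide)
      simp [crossing, List.product] at k3 k4
      have p3 := B.fpos (r := 3) (by decide)
      rw [f3] at p3
      omega
    · rw [hw] at h; exact absurd h (by decide)
  · exact absurd rfl hne
  · rw [e2, w2] at hwz
    exact absurd hwz (by decide)
  · have w1 : w {0, 4, 2} = 0 := by
      have := B.win3b 0 2 4 (by omega) (by omega) (by omega) (by decide)
      rwa [show ({0, 4, 2} : Finset (Fin 6)) = {0, 2, 4} by decide]
    rw [w1] at c1
    omega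

theorem Bad.type2 (B : Bad m w Finset.univ (Finset.univ.erase 5) 0 5)
    (f0 : w (Finset.univ.erase 0) = 1) (f1 : w (Finset.univ.erase 1) = 2)
    (f2 : w (Finset.univ.erase 2) = 3) (f3 : w (Finset.univ.erase 3) = 1)
    (f4 : w (Finset.univ.erase 4) = 2) : False := by
  obtain ⟨g1, g2, g3, g4, g5, g6, g7, g8, g9⟩ := B.facts2 f0 f1 f2 f3 f4
  have hp := B.pos
  have p0 := B.fpos (r := 0) (by decide)
  have p1 := B.fpos (r := 1) (by decide)
  have p2 := B.fpos (r := 2) (by decide)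
  have p4 := B.fpos (r := 4) (by decide)
  rw [f0] at p0; rw [f1] at p1; rw [f2] at p2; rw [f4] at p4
  obtain ⟨a1, a2, a3, a4, a5, a6, a7, a8, a9, a10, a11, a12, a13, a14, a15⟩ := B.antis
  have e0 : ({0, 1, 2, 4} : Finset (Fin 6)).erase 0 = {1, 2, 4} := by decide
  have e1 : ({0, 1, 2, 4} : Finset (Fin 6)).erase 1 = {0, 2, 4} := by decide
  have e2 : ({0, 1, 2, 4} : Finset (Fin 6)).erase 2 = {0, 1, 4} := by decide
  have e4 : ({0, 1, 2, 4} : Finset (Fin 6)).erase 4 = {1, 0, 2} := by decide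
  have w1 : w {0, 2, 4} = 0 := B.win3b 0 2 4 (by omega) (by omega) (by omega) (by decide)
  have w2 : w {0, 1, 4} = 0 := B.win3a 0 1 4 (by omega) (by omega) (by decide)
  by_cases h12 : m 1 2 ≤ m 0 1
  · rcases B.common1 f0 f1 f3 g1 g2 g3 with hw | ⟨hw, _⟩
    · obtain ⟨z, hz, hne, hwz, hc⟩ := B.spec6 hw (by decide)
      have c1 := hc 1 (by decide)
      rw [e1, w1] at c1
      have hz' : z = 0 ∨ z = 1 ∨ z = 2 ∨ z = 4 := by simpa using hz
      rcases hz' with rfl | rfl | rfl | rfl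
      · omega
      · exact absurd rfl hne
      · rw [e2, w2] at hwz
        exact absurd hwz (by decide)
      · rw [e4] at hwz
        have k1 := B.cutS hwz {1} 0 (by decide)
        simp [crossing, List.product] at k1
        omega
    · have k1 := B.cutS hw {1} 0 (by decide)
      have k2 := B.cross 1 (by decide) 5 (by decide) (by decide)
      simp [crossing, List.product] at k1
      omega
  · have w4 : w {1, 0, 2} = 1 := B.win3b 1 0 2 (by omega) (by omega) (by omega) (by decide)
    rcases B.common2 f0 g3 g4 with h | ⟨_, h⟩ | h
    · obtain ⟨z, hz, hne, hwz, hc⟩ := B.spec6 h (by decide)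
      have c1 := hc 0 (by decide)
      have w5 : w {2, 4, 3} = 2 := B.win3b 2 4 3 (by omega) (by omega) (by omega) (by decide)
      rw [show ({0, 2, 3, 4} : Finset (Fin 6)).erase 0 = {2, 4, 3} by decide, w5] at c1
      have hz' : z = 0 ∨ z = 2 ∨ z = 3 ∨ z = 4 := by simpa using hz
      rcases hz' with rfl | rfl | rfl | rfl
      · exact absurd rfl hne
      · omega
      · omega
      · rw [show ({0, 2, 3, 4} : Finset (Fin 6)).erase 4 = {0, 2, 3} by decide] at hwz
        have k1 := B.cutS hwz {0, 3} 2 (by decide)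
        simp [crossing, List.product] at k1
        omega
    · have k1 := B.cutS h {4, 2, 3} 1 (by decide)
      simp [crossing, List.product] at k1
      omega
    · obtain ⟨z, hz, hne, hwz, hc⟩ := B.spec6 h (by decide)
      have c4 := hc 4 (by decide)
      rw [e4, w4] at c4
      have hz' : z = 0 ∨ z = 1 ∨ z = 2 ∨ z = 4 := by simpa using hz
      rcases hz' with rfl | rfl | rfl | rfl
      · exact absurd rfl hne
      · omega
      · omega
      · rw [e4, w4] at hwz
        exact absurd hwz (by decide)

end fin6

section transport
variable {m : X → X → ℤ} {w : Finset X → X} {V R : Finset X} {a b : X}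

theorem UU.pull {g : Fin 6 → X} (hg : Function.Injective g) {S : Finset (Fin 6)} {x : Fin 6}
    (h : UU m (S.image g) (g x)) : UU (fun i j => m (g i) (g j)) S x := by
  intro T hT hx y hy hyT
  obtain ⟨t, ht, u, hu, huT, hlt⟩ := h (T.image g) (Finset.image_subset_image hT)
    (Finset.mem_image_of_mem g hx) (g y) (Finset.mem_image_of_mem g hy)
    (by rw [hg.mem_finset_image]; exact hyT)
  obtain ⟨t', ht', rfl⟩ := Finset.mem_image.1 ht
  obtain ⟨u', hu', rfl⟩ := Finset.mem_image.1 hu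
  rw [hg.mem_finset_image] at huT
  exact ⟨t', ht', u', hu', huT, hlt⟩

theorem Bad.transport (B : Bad m w V R a b) (g : Fin 6 → X) (hg : Function.Injective g)
    (hV : V = Finset.univ.image g) (hR : R = (Finset.univ.erase 5).image g)
    (h0 : g 0 = a) (h5 : g 5 = b) :
    ∃ (m' : Fin 6 → Fin 6 → ℤ) (w' : Finset (Fin 6) → Fin 6),
      Bad m' w' Finset.univ (Finset.univ.erase 5) 0 5 ∧
      ∀ i j, w (V.erase (g i)) = g j → w' (Finset.univ.erase i) = j := by
  have hsub : ∀ S : Finset (Fin 6), S.image g ⊆ V := fun S => by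
    rw [hV]; exact Finset.image_subset_image (Finset.subset_univ _)
  have hw : ∀ S : Finset (Fin 6), S.Nonempty →
      g (Function.invFun g (w (S.image g))) = w (S.image g) := fun S hS => by
    obtain ⟨i, _, hi⟩ := Finset.mem_image.1 (B.mem _ (hsub S) (hS.image g))
    exact Function.invFun_eq ⟨i, hi⟩
  have her : ∀ (S : Finset (Fin 6)) (d : Fin 6), (S.erase d).image g = (S.image g).erase (g d) :=
    fun S d => Finset.image_erase hg S d
  have hne : ∀ i : Fin 6, (Finset.univ.erase i).Nonempty := by decide
  have hwe : ∀ i : Fin 6, g (Function.invFun g (w ((Finset.univ.erase i).image g)))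
      = w (V.erase (g i)) := fun i => by
    rw [hw _ (hne i), her, hV]
  subst h0 h5
  refine ⟨fun i j => m (g i) (g j), fun S => Function.invFun g (w (S.image g)), ?_, ?_⟩
  · refine ⟨⟨?_, ?_, ?_⟩, ?_, ?_, ?_, ?_, ?_, ?_, ?_, ?_, ?_⟩
    · intro x y; exact B.anti _ _
    · intro S _ hS
      rw [← hg.mem_finset_image, hw S hS]
      exact B.mem _ (hsub S) (hS.image g)
    · intro S _ hS
      obtain ⟨y, hy, h1, h2, h3⟩ := B.spec _ (hsub S) (by rwa [Finset.card_image_of_injective _ hg])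
      obtain ⟨y, hyS, rfl⟩ := Finset.mem_image.1 hy
      clear hy
      have hy := hyS
      have hSn : S.Nonempty := ⟨y, hy⟩
      have hS' : ∀ d, (S.erase d).Nonempty := fun d => by
        rw [← Finset.card_pos]
        have := Finset.pred_card_le_card_erase (s := S) (a := d)
        omega
      refine ⟨y, hy, ?_, ?_, ?_⟩
      · intro h
        apply h1
        rw [← hw S hSn, h]
      · show Function.invFun g (w ((S.erase y).image g)) = _
        rw [her, h2]
      · intro d hd
        show m (g (Function.invFun g (w ((S.erase d).image g)))) (g d) ≤
          m (g (Function.invFun g (w (S.image g)))) (g y)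
        rw [hw _ (hS' d), hw _ hSn, her]
        exact h3 _ (Finset.mem_image_of_mem g hd)
    · intro S _ hSV hS
      apply UU.pull hg
      rw [hw S hS]
      apply B.und _ (hsub S) _ (hS.image g)
      intro h
      apply hSV
      rw [hV] at h
      exact Finset.image_injective hg h
    · simp
    · decide
    · simp
    · simp
    · apply hg
      rw [hwe, B.fb]
    · exact B.pos
    · intro r hr q hq hqR
      refine B.cross _ ?_ _ ?_ ?_
      · rw [hR]; exact Finset.mem_image_of_mem g hr
      · rw [hV]; exact Finset.mem_image_of_mem g hq
      · rw [hR, hg.mem_finset_image]; exact hqR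
    · intro d _ hd
      show m (g 5) (g 0) < m (g d) (g _)
      rw [hwe]
      exact B.fdown _ (by rw [hV]; exact Finset.mem_image_of_mem g (Finset.mem_univ _))
        (fun h => hd (hg h))
  · intro i j h
    apply hg
    show g _ = _
    rw [hwe, h]

theorem Bad.five (B : Bad m w V R a b) (hV : V.card ≤ 6) {c1 c2 c3 c4 : X}
    (hR : R = {a, c1, c2, c3, c4}) (hn : [a, c1, c2, c3, c4].Nodup) 
    (f0 : w (V.erase a) = c1) (f1 : w (V.erase c1) = c2) (f2 : w (V.erase c2) = c3)
    (f34 : (w (V.erase c3) = c4 ∧ (w (V.erase c4) = c1 ∨ w (V.erase c4) = c2)) ∨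
      (w (V.erase c3) = c1 ∧ (w (V.erase c4) = c1 ∨ w (V.erase c4) = c2 ∨ w (V.erase c4) = c3))) :
    False := by
  have hbR := B.hbR
  have hnn : [a, c1, c2, c3, c4, b].Nodup := by
    rw [hR] at hbR
    simp at hbR hn ⊢
    tauto
  have hg : Function.Injective ![a, c1, c2, c3, c4, b] := by
    have := List.nodup_iff_injective_get.1 hnn
    intro i j hij
    apply this
    fin_cases i <;> fin_cases j <;> first | rfl | exact hij
  have hR' : R = (Finset.univ.erase 5).image ![a, c1, c2, c3, c4, b] := by
    rw [show (Finset.univ.erase 5 : Finset (Fin 6)) = {0, 1, 2, 3, 4} by decide, hR]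
    simp [Finset.image_insert]
  have hV' : V = Finset.univ.image ![a, c1, c2, c3, c4, b] := by
    symm
    apply Finset.eq_of_subset_of_card_le
    · intro x hx
      obtain ⟨i, _, rfl⟩ := Finset.mem_image.1 hx
      by_cases h5 : i = 5
      · subst h5; exact B.hb
      · apply B.sub
        rw [hR', hg.mem_finset_image]
        simp [h5]
    · rw [Finset.card_image_of_injective _ hg]; simpa using hV
  obtain ⟨m', w', B', hw'⟩ := B.transport _ hg hV' hR' rfl rfl
  have F0 := hw' 0 1 f0
  have F1 := hw' 1 2 f1
  have F2 := hw' 2 3 f2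
  rcases f34 with ⟨f3, f4 | f4⟩ | ⟨f3, f4 | f4 | f4⟩
  · exact B'.t41 F0 F1 F2 (hw' 3 4 f3) (hw' 4 1 f4)
  · exact B'.t42 F0 F1 F2 (hw' 3 4 f3) (hw' 4 2 f4)
  · exact B'.type1 F0 F1 F2 (hw' 3 1 f3) (hw' 4 1 f4)
  · exact B'.type2 F0 F1 F2 (hw' 3 1 f3) (hw' 4 2 f4)
  · exact B'.t13 F0 F1 F2 (hw' 3 1 f3) (hw' 4 3 f4)

theorem Bad.false (B : Bad m w V R a b) (hV : V.card ≤ 6) : False := by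
  have hRc : R.card ≤ 5 := by
    have : R ⊆ V.erase b := fun z hz => Finset.mem_erase.2
      ⟨by rintro rfl; exact B.hbR hz, B.sub hz⟩
    have := Finset.card_le_card this
    rw [Finset.card_erase_of_mem B.hb] at this
    omega
  have full : ∀ c0 c1 c2 c3 c4 : X, c0 ∈ R → c1 ∈ R → c2 ∈ R → c3 ∈ R → c4 ∈ R →
      [c0, c1, c2, c3, c4].Nodup → R = {c0, c1, c2, c3, c4} := by
    intro c0 c1 c2 c3 c4 h0 h1 h2 h3 h4 hn
    symm
    apply Finset.eq_of_subset_of_card_le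
    · simp [Finset.insert_subset_iff, *]
    · have : ({c0, c1, c2, c3, c4} : Finset X) = [c0, c1, c2, c3, c4].toFinset := by simp
      rw [this, List.toFinset_card_of_nodup hn]
      simpa using hRc
  have ia := B.ha
  obtain ⟨c1, h1⟩ : ∃ c, c = w (V.erase a) := ⟨_, rfl⟩
  obtain ⟨c2, h2⟩ : ∃ c, c = w (V.erase c1) := ⟨_, rfl⟩
  obtain ⟨c3, h3⟩ : ∃ c, c = w (V.erase c2) := ⟨_, rfl⟩
  obtain ⟨c4, h4⟩ : ∃ c, c = w (V.erase c3) := ⟨_, rfl⟩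
  have i1 : c1 ∈ R := h1 ▸ B.fR ia
  have i2 : c2 ∈ R := h2 ▸ B.fR i1
  have i3 : c3 ∈ R := h3 ▸ B.fR i2
  have i4 : c4 ∈ R := h4 ▸ B.fR i3
  have i5 := B.fR i4
  have n1 : c1 ≠ a := h1 ▸ B.fne_a ia
  have n2 : c2 ≠ a := h2 ▸ B.fne_a i1
  have n3 : c3 ≠ a := h3 ▸ B.fne_a i2
  have n4 : c4 ≠ a := h4 ▸ B.fne_a i3
  have n5 := B.fne_a i4
  have e2 : c2 ≠ c1 := by have := B.fne i1; rwa [← h2] at this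
  have e3 : c3 ≠ c2 := by have := B.fne i2; rwa [← h3] at this
  have e4 : c4 ≠ c3 := by have := B.fne i3; rwa [← h4] at this
  have e5 := B.fne i4
  have t1 : c3 ≠ c1 := fun h => B.f2 i1 i2 h2.symm (h3.symm.trans h)
  have t2 : c4 ≠ c2 := fun h => B.f2 i2 i3 h3.symm (h4.symm.trans h)
  have t3 := B.f2 i3 i4 h4.symm
  have n31 : c3 ≠ c1 := t1
  have n42 : c4 ≠ c2 := t2
  by_cases h41 : c4 = c1
  · subst h41
    by_cases hR : R = {a, c4, c2, c3}
    · exact B.four hR n1.symm n2.symm n3.symm e2.symm n31.symm e3.symm h1.symm h2.symm h3.symm h4.symm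
    · obtain ⟨e, he, hne⟩ : ∃ e ∈ R, e ∉ ({a, c4, c2, c3} : Finset X) := by
        by_contra hcon
        push Not at hcon
        apply hR
        apply Finset.Subset.antisymm hcon
        simp [Finset.insert_subset_iff, ia, i1, i2, i3]
      simp only [Finset.mem_insert, Finset.mem_singleton, not_or] at hne
      obtain ⟨q0, q1, q2, q3⟩ := hne
      have hnd : [a, c4, c2, c3, e].Nodup := by
        simp
        refine ⟨⟨n1.symm, n2.symm, n3.symm, Ne.symm q0⟩, ⟨e2.symm, n31.symm, Ne.symm q1⟩,
          ⟨e3.symm, Ne.symm q2⟩, Ne.symm q3⟩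
      have hR5 := full a c4 c2 c3 e ia i1 i2 i3 he hnd
      have x1 := B.fR he
      have x2 := B.fne_a he
      have x3 := B.fne he
      rw [hR5] at x1
      simp only [Finset.mem_insert, Finset.mem_singleton] at x1
      refine B.five hV hR5 hnd h1.symm h2.symm h3.symm (Or.inr ⟨h4.symm, ?_⟩)
      tauto
  · have hnd : [a, c1, c2, c3, c4].Nodup := by
      simp
      refine ⟨⟨n1.symm, n2.symm, n3.symm, n4.symm⟩, ⟨e2.symm, n31.symm, Ne.symm h41⟩,
          ⟨e3.symm, n42.symm⟩, e4.symm⟩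
    have hR5 := full a c1 c2 c3 c4 ia i1 i2 i3 i4 hnd
    refine B.five hV hR5 hnd h1.symm h2.symm h3.symm (Or.inl ⟨h4.symm, ?_⟩)
    rw [hR5] at i5
    simp only [Finset.mem_insert, Finset.mem_singleton] at i5
    tauto

end transport

section final
variable {m : X → X → ℤ} {w : Finset X → X} {V : Finset X}

theorem Base.mono (B : Base m w V) {S : Finset X} (hS : S ⊆ V) : Base m w S :=
  ⟨B.anti, fun U hU => B.mem U (hU.trans hS), fun U hU => B.spec U (hU.trans hS)⟩

theorem Base.allUU (B : Base m w V)
    (inj : ∀ a ∈ V, ∀ b ∈ V, ∀ c ∈ V, ∀ d ∈ V, a ≠ b → c ≠ d → m a b = m c d → a = c) :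
    ∀ n, ∀ S ⊆ V, S.card = n → S.card ≤ 6 → S.Nonempty → UU m S (w S) := by
  intro n
  induction n using Nat.strong_induction_on with
  | _ n ih =>
  intro S hSV hn h6 hS T hT hx y hy hyT
  by_cases h2 : S.card < 2
  · exfalso
    have := Finset.card_le_one.1 (show S.card ≤ 1 by omega) _ (hT hx) y hy
    rw [this] at hx
    exact hyT hx
  obtain ⟨b, hb, hne, hw, hc⟩ := B.spec S hSV (by omega)
  have hwS := hT hx
  have ih' : ∀ U ⊆ S, U ≠ S → U.Nonempty → UU m U (w U) := by
    intro U hU hUS hUn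
    have hlt := Finset.card_lt_card (lt_of_le_of_ne hU hUS)
    exact ih U.card (by omega) U (hU.trans hSV) rfl (by omega) hUn
  by_cases hyb : y = b
  · subst hyb
    by_contra hcon
    push Not at hcon
    have hab := hcon _ hx y hb hyT
    have ean := B.anti (w S) y
    have hpos : 0 < m y (w S) := by
      rcases lt_or_eq_of_le (show 0 ≤ m y (w S) by omega) with h | h
      · exact h
      · exact absurd (inj _ (hSV hwS) _ (hSV hb) _ (hSV hb) _ (hSV hwS) hne hne.symm (by omega)) hne
    have bad : Bad m w S T (w S) y := by
      refine ⟨B.mono hSV, ih', hT, hx, hb, hyT, hw, hpos, ?_, ?_⟩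
      · intro r hr q hq hqT
        rcases lt_or_eq_of_le (hcon r hr q hq hqT) with h | h
        · exact h
        · have := inj _ (hSV (hT hr)) _ (hSV hq) _ (hSV hb) _ (hSV hwS)
            (by rintro rfl; exact hqT hr) hne.symm h
          exact absurd hr (this ▸ hyT)
      · intro d hd hdy
        have h1 := hc d hd
        have h2 := B.anti (w (S.erase d)) d
        have h3 : w (S.erase d) ∈ S.erase d := B.mem _ ((Finset.erase_subset _ _).trans hSV)
          ⟨y, by simp [hb, Ne.symm hdy]⟩
        rw [Finset.mem_erase] at h3
        rcases lt_or_eq_of_le (show m y (w S) ≤ m d (w (S.erase d)) by omega) with h | h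
        · exact h
        · exact absurd (inj _ (hSV hb) _ (hSV hwS) _ (hSV hd) _ (hSV h3.2) hne.symm h3.1.symm h).symm
            hdy
    exact bad.false h6
  · have h := ih' (S.erase b) (Finset.erase_subset _ _)
      (by intro h; rw [← h] at hb; simp at hb) ⟨y, by simp [hy, hyb]⟩
    rw [hw] at h
    obtain ⟨t, ht, u, hu, huT, hlt⟩ := h (T.erase b) (Finset.erase_subset_erase _ hT)
      (by simp [hx, hne]) y (by simp [hy, hyb]) (by simp [hyT])
    simp only [Finset.mem_erase, not_and] at ht hu huT
    exact ⟨t, ht.2, u, hu.2, huT hu.1, hlt⟩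

/-- margins representing a linear ordinal margin matrix -/
theorem exists_margin {succ : X × X → X × X → Prop} (h : IsOMM V succ) :
    ∃ m : X → X → ℤ, (∀ x y, m y x = - m x y) ∧
      ∀ a ∈ V, ∀ b ∈ V, ∀ c ∈ V, ∀ d ∈ V, succ (a, b) (c, d) → m c d < m a b := by
  classical
  obtain ⟨hne, hasym, hneg, hskew⟩ := h
  let r : X × X → ℕ := fun p => ((V ×ˢ V).filter fun q => succ p q).card
  have hr : ∀ p q : X × X, p.1 ∈ V → p.2 ∈ V → q.1 ∈ V → q.2 ∈ V → succ p q → r q < r p := by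
    intro p q p1 p2 q1 q2 hpq
    apply Finset.card_lt_card
    rw [Finset.ssubset_iff_of_subset]
    · refine ⟨q, by simp [q1, q2, hpq], ?_⟩
      simp only [Finset.mem_filter, not_and]
      intro _ hqq
      exact hasym q q q1 q2 q1 q2 hqq hqq
    · intro s hs
      simp only [Finset.mem_filter, Finset.mem_product] at hs ⊢
      refine ⟨hs.1, ?_⟩
      by_contra hps
      exact hneg p s q p1 p2 hs.1.1 hs.1.2 q1 q2 hps
        (hasym q s q1 q2 hs.1.1 hs.1.2 hs.2) hpq
  refine ⟨fun x y => (r (x, y) : ℤ) - r (y, x), fun x y => by ring, ?_⟩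
  intro a ha b hb c hc d hd hs
  have h1 := hr _ _ ha hb hc hd hs
  have h2 := hr _ _ hd hc hb ha ((hskew a b c d ha hb hc hd).1 hs)
  show (r (c, d) : ℤ) - r (d, c) < (r (a, b) : ℤ) - r (b, a)
  omega

theorem ssv_unique {succ : X × X → X × X → Prop} (h : IsLinearOMM V succ) :
    ∀ n, ∀ S ⊆ V, S.card = n + 1 → ∃ a ∈ S, ∀ c, SSVwinAux succ (n + 1) S c ↔ c = a := by
  obtain ⟨m, hanti, hm⟩ := exists_margin h.1
  obtain ⟨⟨_, hasym, _, _⟩, hlin⟩ := h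
  intro n
  induction n with
  | zero =>
    intro S hS hc
    obtain ⟨a, rfl⟩ := Finset.card_eq_one.1 hc
    refine ⟨a, by simp, fun c => ?_⟩
    simp [SSVwinAux, eq_comm]
  | succ n ih =>
    intro S hS hc
    have hf : ∀ d : X, ∃ a, d ∈ S → a ∈ S.erase d ∧ ∀ c, SSVwinAux succ (n + 1) (S.erase d) c ↔ c = a := by
      intro d
      by_cases hd : d ∈ S
      · obtain ⟨a, h1, h2⟩ := ih (S.erase d) ((Finset.erase_subset _ _).trans hS)
          (by rw [Finset.card_erase_of_mem hd]; omega)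
        exact ⟨a, fun _ => ⟨h1, h2⟩⟩
      · exact ⟨d, fun h => absurd h hd⟩
    choose f hf using hf
    have hSn : S.Nonempty := Finset.card_pos.1 (by omega)
    obtain ⟨b, hb, hmax⟩ := Finset.exists_max_image S (fun d => m (f d) d) hSn
    have hfS : ∀ d ∈ S, f d ∈ S ∧ f d ≠ d := fun d hd => by
      have := (hf d hd).1
      simp only [Finset.mem_erase] at this
      exact ⟨this.2, this.1⟩
    have hdom : ∀ d ∈ S, (f d, d) ≠ (f b, b) → succ (f b, b) (f d, d) := by
      intro d hd hne
      rcases hlin (f b) b (f d) d (hS (hfS b hb).1) (hS hb) (hS (hfS d hd).1) (hS hd)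
        (hfS b hb).2 (hfS d hd).2 hne.symm with h | h
      · exact h
      · have h1 := hm _ (hS (hfS d hd).1) _ (hS hd) _ (hS (hfS b hb).1) _ (hS hb) h
        have h2 := hmax d hd
        omega
    refine ⟨f b, (hfS b hb).1, fun c => ?_⟩
    rw [SSVwinAux]
    constructor
    · rintro (h | ⟨_, b', hb', hcb, hw, hall⟩)
      · rw [h] at hc; simp at hc
      · have hcf := ((hf b' hb').2 c).1 hw
        by_contra hne
        have h1 := hall (f b) b hb (hf b hb).1 (fun h => hne (by simpa using (congrArg Prod.fst h).symm))
          (((hf b hb).2 _).2 rfl)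
        have h2 := hdom b' hb' (fun h => hne (by rw [hcf]; exact congrArg Prod.fst h))
        rw [hcf] at h1
        exact hasym _ _ (hS (hfS b hb).1) (hS hb) (hS (hfS b' hb').1) (hS hb') h2 h1
    · rintro rfl
      refine Or.inr ⟨by omega, b, hb, (hf b hb).1, ((hf b hb).2 _).2 rfl, ?_⟩
      intro c d hd hcd hne hw
      have := ((hf d hd).2 c).1 hw
      subst this
      exact hdom d hd hne

theorem exists_base {succ : X × X → X × X → Prop} (h : IsLinearOMM V succ) :
    ∃ (m : X → X → ℤ) (w : Finset X → X), Base m w V ∧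
      (∀ a ∈ V, ∀ b ∈ V, ∀ c ∈ V, ∀ d ∈ V, succ (a, b) (c, d) → m c d < m a b) ∧
      (∀ a, SSVwin V succ a → a = w V) := by
  have hu := ssv_unique h
  obtain ⟨m, hanti, hm⟩ := exists_margin h.1
  obtain ⟨v0, hv0⟩ := h.1.1
  have hf : ∀ S : Finset X, ∃ a, S ⊆ V → S.Nonempty → a ∈ S ∧ ∀ c, SSVwinAux succ S.card S c ↔ c = a := by
    intro S
    by_cases hS : S ⊆ V ∧ S.Nonempty
    · have hp := Finset.card_pos.2 hS.2
      obtain ⟨a, h1, h2⟩ := hu (S.card - 1) S hS.1 (by omega)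
      rw [show S.card - 1 + 1 = S.card by omega] at h2
      exact ⟨a, fun _ _ => ⟨h1, h2⟩⟩
    · exact ⟨v0, fun h1 h2 => absurd ⟨h1, h2⟩ hS⟩
  choose w hw using hf
  refine ⟨m, w, ⟨hanti, fun S hS hn => (hw S hS hn).1, ?_⟩, hm,
    fun a ha => ((hw V (Finset.Subset.refl _) ⟨v0, hv0⟩).2 a).1 ha⟩
  intro S hS hc
  have hSn : S.Nonempty := Finset.card_pos.1 (by omega)
  have hself := ((hw S hS hSn).2 (w S)).2 rfl
  obtain ⟨k, hk⟩ : ∃ k, S.card = k + 1 := ⟨S.card - 1, by omega⟩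
  have hke : ∀ d ∈ S, (S.erase d).card = k := fun d hd => by
    rw [Finset.card_erase_of_mem hd]; omega
  have hwe : ∀ d ∈ S, w (S.erase d) ∈ S.erase d ∧
      ∀ c, SSVwinAux succ k (S.erase d) c ↔ c = w (S.erase d) := by
    intro d hd
    have := hw (S.erase d) ((Finset.erase_subset _ _).trans hS)
      (Finset.card_pos.1 (by rw [hke d hd]; omega))
    rwa [hke d hd] at this
  rw [hk, SSVwinAux] at hself
  rcases hself with h1 | ⟨_, b, hb, hab, hwb, hall⟩
  · rw [h1] at hc; simp at hc
  · refine ⟨b, hb, (Finset.mem_erase.1 hab).1, (((hwe b hb).2 _).1 hwb).symm, ?_⟩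
    intro d hd
    have hdm := (hwe d hd).1
    by_cases hne : (w (S.erase d), d) = (w S, b)
    · rw [Prod.mk.injEq] at hne
      rw [hne.1, hne.2]
    · have := hall (w (S.erase d)) d hd hdm hne (((hwe d hd).2 _).2 rfl)
      exact le_of_lt (hm _ (hS (Finset.mem_of_mem_erase hab)) _ (hS hb) _
        (hS (Finset.mem_of_mem_erase hdm)) _ (hS hd) this)

theorem zip_chain {R : X → X → Prop} (c : X) : ∀ (s : List X) (x : X), (x :: s).IsChain R →
    (∀ e ∈ (x :: s).zip (s ++ [c]), R e.1 e.2 ∨ e = ((x :: s).getLast (by simp), c)) ∧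
    ((x :: s).getLast (by simp), c) ∈ (x :: s).zip (s ++ [c]) := by
  intro s
  induction s with
  | nil => intro x _; simp
  | cons y s ih =>
    intro x hx
    rw [List.isChain_cons_cons] at hx
    obtain ⟨h1, h2⟩ := ih y hx.2
    constructor
    · intro e he
      rw [List.cons_append, List.zip_cons_cons, List.mem_cons] at he
      rcases he with rfl | he
      · exact Or.inl hx.1
      · rw [List.getLast_cons (by simp)]
        exact h1 e he
    · rw [List.cons_append, List.zip_cons_cons, List.getLast_cons (by simp)]
      exact List.mem_cons_of_mem _ h2

/-- `z` can be reached from `x` by a duplicate-free `R`-chain inside `V` -/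
def Reach (R : X → X → Prop) (V : Finset X) (x z : X) : Prop :=
  ∃ s : List X, (x :: s).Nodup ∧ (∀ v ∈ x :: s, v ∈ V) ∧ (x :: s).IsChain R ∧
    (x :: s).getLast (by simp) = z

theorem Reach.step {R : X → X → Prop} {x t u : X} (h : Reach R V x t) (hu : u ∈ V)
    (htu : R t u) : Reach R V x u := by
  obtain ⟨s, h1, h2, h3, h4⟩ := h
  by_cases hmem : u ∈ x :: s
  · obtain ⟨p, q, hpq⟩ := List.append_of_mem hmem
    cases p with
    | nil =>
      simp at hpq
      refine ⟨[], by simp, by simpa using h2 x (by simp), by simp, by simp [hpq.1]⟩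
    | cons x' p =>
      rw [List.cons_append, List.cons.injEq] at hpq
      obtain ⟨rfl, rfl⟩ := hpq
      have hpre : (x :: (p ++ [u])) <+: (x :: (p ++ u :: q)) := ⟨q, by simp⟩
      refine ⟨p ++ [u], h1.sublist hpre.sublist, fun v hv => h2 v (hpre.subset hv),
        h3.prefix hpre, by simp⟩
  · refine ⟨s ++ [u], ?_, ?_, ?_, by simp⟩
    · rw [← List.cons_append]
      rw [List.nodup_append]
      refine ⟨h1, by simp, ?_⟩
      intro a ha b hb
      rw [List.mem_singleton] at hb
      subst hb
      rintro rfl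
      exact hmem ha
    · intro v hv
      rw [← List.cons_append, List.mem_append, List.mem_singleton] at hv
      rcases hv with hv | rfl
      · exact h2 v hv
      · exact hu
    · rw [← List.cons_append, List.isChain_append]
      refine ⟨h3, by simp, ?_⟩
      intro a ha b hb
      rw [List.getLast?_eq_getLast_of_ne_nil (by simp)] at ha
      simp at ha hb
      subst hb
      rw [← ha]
      simpa [h4] using htu

theorem UU.reach {x y : X} (h : UU m V x) (hx : x ∈ V) (hy : y ∈ V) :
    Reach (fun t u => m y x < m t u) V x y := by
  classical
  by_contra hcon
  obtain ⟨t, ht, u, hu, huT, hlt⟩ := h (V.filter fun z => Reach (fun t u => m y x < m t u) V x z)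
    (Finset.filter_subset _ _)
    (by
      simp only [Finset.mem_filter]
      exact ⟨hx, [], by simp, by simpa using hx, by simp, by simp⟩) y hy (by simp [hcon])
  simp only [Finset.mem_filter, not_and] at ht huT
  exact huT hu (ht.2.step hu hlt)

end final
end SSVproof

/-- For every ordinal margin matrix with at most 6 alternatives, every SSV-PUT
winner is a Split Cycle winner. -/
theorem ssvput_refines_sc_up_to_six {X : Type} [DecidableEq X] (V : Finset X)
    (succ : X × X → X × X → Prop) (h : IsOMM V succ) (hcard : V.card ≤ 6) :
    ∀ a, SSVPUTwin V succ a → SCwinner V succ a := by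
  rintro a ⟨succ', ⟨hlin, hext⟩, hwin⟩
  obtain ⟨m, w, B, hm, hw⟩ := SSVproof.exists_base hlin
  obtain rfl := hw a hwin
  have hVn : V.Nonempty := h.1
  have hinj : ∀ a ∈ V, ∀ b ∈ V, ∀ c ∈ V, ∀ d ∈ V, a ≠ b → c ≠ d → m a b = m c d → a = c := by
    intro a ha b hb c hc d hd hab hcd he
    by_contra hne
    rcases hlin.2 a b c d ha hb hc hd hab hcd (fun h => hne (congrArg Prod.fst h)) with h | h
    · have := hm _ ha _ hb _ hc _ hd h
      omega
    · have := hm _ hc _ hd _ ha _ hb h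
      omega
  have hUU := B.allUU hinj _ V (Finset.Subset.refl _) rfl hcard hVn
  have hx := B.mem V (Finset.Subset.refl _) hVn
  refine ⟨hx, ?_⟩
  rintro y hy ⟨_, _, hyx, hno⟩
  obtain ⟨s, h1, h2, h3, h4⟩ := hUU.reach hx hy
  obtain ⟨_, hasym, hneg, hskew⟩ := h
  have hz := SSVproof.zip_chain (w V) s (w V) h3
  rw [h4] at hz
  apply hno
  have hrot : (w V :: s).rotate 1 = s ++ [w V] := by simp
  have hmemV : ∀ e ∈ (w V :: s).zip (s ++ [w V]), e.1 ∈ V ∧ e.2 ∈ V := by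
    rintro ⟨e1, e2⟩ he
    obtain ⟨q1, q2⟩ := List.of_mem_zip he
    refine ⟨h2 _ q1, ?_⟩
    rw [List.mem_append, List.mem_singleton] at q2
    rcases q2 with q2 | rfl
    · exact h2 _ (List.mem_cons_of_mem _ q2)
    · exact hx
  have hge : ∀ e ∈ (w V :: s).zip (s ++ [w V]), ¬ succ (y, w V) (e.1, e.2) := by
    intro e he hs
    obtain ⟨v1, v2⟩ := hmemV e he
    rcases hz.1 e he with hlt | rfl
    · have := hm _ hy _ hx _ v1 _ v2 (hext _ _ hy hx v1 v2 hs)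
      omega
    · exact hasym _ _ hy hx hy hx hs hs
  refine ⟨w V :: s, h1, h2, ?_, ?_, ?_⟩
  · rw [hrot]
    intro e he
    obtain ⟨v1, v2⟩ := hmemV e he
    have hn := hge e he
    by_contra hcon
    have hn2 : ¬ succ (e.2, e.1) (w V, y) := fun hs =>
      hn ((hskew y (w V) e.1 e.2 hy hx v1 v2).2 hs)
    exact hneg _ _ _ hy hx v2 v1 hx hy (hneg _ _ _ hy hx v1 v2 v2 v1 hn hcon) hn2 hyx
  · rw [hrot]; exact hz.2
  · rw [hrot]; exact hge
end

section
/- Let M = (X, ≻) be a linear ordinal margin matrix with |X| = n ≥ 2 such that for every linear ordinal margin matrix with fewer than n alternatives the SSV winner is a Split Cycle winner. Suppose a is the SSV winner of M, witnessed by the ≻-maximal pair (a,b) such that a is the SSV winner of M_{-b}. Then if some alternative c defeats a according to Split Cycle in M, we must have c = b. -/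
variable {X : Type} [DecidableEq X]

/-- Let `M = (X, ≻)` be a linear ordinal margin matrix with `|X| = n ≥ 2` such
that for every linear ordinal margin matrix with fewer than `n` alternatives the SSV winner
is a Split Cycle winner. Suppose `a` is the SSV winner of `M`, witnessed by the `≻`-maximal
pair `(a,b)` such that `a` is the SSV winner of `M` with `b` deleted. Then if some
alternative `c` Split-Cycle-defeats `a` in `M`, we must have `c = b`. -/
theorem sc_defeater_of_ssv_winner_is_witness {X : Type} [DecidableEq X] (V : Finset X)
    (succ : X × X → X × X → Prop) (hlin : IsLinearOMM V succ) (hcard : 2 ≤ V.card)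
    (IH : ∀ (Y : Type) [DecidableEq Y] (W : Finset Y) (succ' : Y × Y → Y × Y → Prop),
      W.card < V.card → IsLinearOMM W succ' → ∀ x, SSVwin W succ' x → SCwinner W succ' x)
    (a b : X) (hb : b ∈ V) (hab : a ∈ V.erase b)
    (hwin : SSVwin (V.erase b) succ a)
    (hmax : ∀ c d : X, d ∈ V → c ∈ V.erase d → (c, d) ≠ (a, b) →
      SSVwin (V.erase d) succ c → succ (a, b) (c, d)) :
    ∀ c, SCdefeats V succ c a → c = b := by
  intro c hc
  by_contra hcb
  obtain ⟨hcV, haV, hca, hno⟩ := hc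
  have hsub : ∀ x, x ∈ V.erase b → x ∈ V := fun x hx => Finset.mem_of_mem_erase hx
  have hlin' : IsLinearOMM (V.erase b) succ := by
    obtain ⟨⟨_, h1, h2, h3⟩, h4⟩ := hlin
    refine ⟨⟨⟨a, hab⟩, ?_, ?_, ?_⟩, ?_⟩
    · intro p q a1 a2 a3 a4
      exact h1 p q (hsub _ a1) (hsub _ a2) (hsub _ a3) (hsub _ a4)
    · intro p q r a1 a2 a3 a4 a5 a6
      exact h2 p q r (hsub _ a1) (hsub _ a2) (hsub _ a3) (hsub _ a4) (hsub _ a5) (hsub _ a6)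
    · intro x y z w a1 a2 a3 a4
      exact h3 x y z w (hsub _ a1) (hsub _ a2) (hsub _ a3) (hsub _ a4)
    · intro x y z w a1 a2 a3 a4
      exact h4 x y z w (hsub _ a1) (hsub _ a2) (hsub _ a3) (hsub _ a4)
  have hcE : c ∈ V.erase b := Finset.mem_erase.2 ⟨hcb, hcV⟩
  have hw := IH X (V.erase b) succ (Finset.card_erase_lt_of_mem hb) hlin' a hwin
  refine hw.2 c hcE ⟨hcE, hab, hca, ?_⟩
  rintro ⟨l, hl1, hl2, hl3⟩
  exact hno ⟨l, hl1, fun x hx => hsub x (hl2 x hx), hl3⟩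
end

section
/- There exists a linear ordinal margin matrix with exactly 8 alternatives that has exactly one Split Cycle winner, and this unique Split Cycle winner defeats the SSV winner according to Split Cycle; in particular, the SSV winner is not a Split Cycle winner. -/
variable {X : Type} [DecidableEq X]

/-- The signed margin ranks of the witness. -/
def mg : Fin 8 → Fin 8 → ℤ :=
  ![
    ![0, 11, -8, -4, -6, -2, -7, 3],
    ![-11, 0, 12, 28, 10, 5, 1, -15],
    ![8, -12, 0, -13, -27, -20, 24, 14],
    ![4, -28, 13, 0, 26, -18, 17, -16],
    ![6, -10, 27, -26, 0, -19, 9, 25],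
    ![2, -5, 20, 18, 19, 0, 21, -22],
    ![7, -1, -24, -17, -9, -21, 0, 23],
    ![-3, 15, -14, 16, -25, 22, -23, 0]]

/-- The witnessing relation. -/
def sc8 (p q : Fin 8 × Fin 8) : Prop := mg q.1 q.2 < mg p.1 p.2

instance : DecidableRel sc8 := fun _ _ => inferInstanceAs (Decidable (_ < _))

theorem mg_skew : ∀ a b, mg a b = - mg b a := by decide +kernel

theorem mg_inj : ∀ a b c d, a ≠ b → c ≠ d → mg a b = mg c d → (a, b) = (c, d) := by
  decide +kernel

theorem sc8_linear : IsLinearOMM (Finset.univ : Finset (Fin 8)) sc8 := by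
  refine ⟨⟨Finset.univ_nonempty, ?_, ?_, ?_⟩, ?_⟩
  · intro p q _ _ _ _ h
    unfold sc8 at *
    omega
  · intro p q r _ _ _ _ _ _ h1 h2
    unfold sc8 at *
    omega
  · intro a b c d _ _ _ _
    have h1 := mg_skew a b
    have h2 := mg_skew c d
    simp only [sc8]
    omega
  · intro a b c d _ _ _ _ h1 h2 h3
    have h : mg a b ≠ mg c d := fun h => h3 (mg_inj a b c d h1 h2 h)
    simp only [sc8]
    omega

/-- A set closed under the steps of a cyclic list contains the whole list as soon as it
contains one of its members. -/
theorem cycle_closed {U : Finset (Fin 8)} {l : List (Fin 8)} {x : Fin 8} (hx : x ∈ l)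
    (hU : x ∈ U) (hc : ∀ e ∈ l.zip (l.rotate 1), e.1 ∈ U → e.2 ∈ U) : ∀ y ∈ l, y ∈ U := by
  obtain ⟨i, hi, rfl⟩ := List.getElem_of_mem hx
  have hn : 0 < l.length := by omega
  have key : ∀ k : ℕ, l[(i + k) % l.length]'(Nat.mod_lt _ hn) ∈ U := by
    intro k
    induction k with
    | zero => simpa [Nat.mod_eq_of_lt hi] using hU
    | succ k ih =>
      have hj : (i + k) % l.length < l.length := Nat.mod_lt _ hn
      have hj2 : (i + k) % l.length < (l.zip (l.rotate 1)).length := by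
        simpa using hj
      have := hc _ (List.getElem_mem hj2)
      rw [List.getElem_zip] at this
      have h2 := this ih
      simp only [List.getElem_rotate] at h2
      have e : ((i + k) % l.length + 1) % l.length = (i + (k + 1)) % l.length := by
        rw [Nat.mod_add_mod, Nat.add_assoc]
      simpa only [e] using h2
  intro y hy
  obtain ⟨j, hj, rfl⟩ := List.getElem_of_mem hy
  have := key (l.length - i + j)
  have e : (i + (l.length - i + j)) % l.length = j := by
    rw [show i + (l.length - i + j) = l.length + j by omega, Nat.add_mod_left,
      Nat.mod_eq_of_lt hj]
  simpa only [e] using this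

/-- A closed set separating `x` from `y` certifies that `y` defeats `x`. -/
theorem defeats_of_closed (U : Finset (Fin 8)) (y x : Fin 8) (hp : sc8 (y, x) (x, y))
    (hx : x ∈ U) (hy : y ∉ U)
    (hc : ∀ u ∈ U, ∀ v, ¬ sc8 (y, x) (u, v) → sc8 (u, v) (v, u) → v ∈ U) :
    SCdefeats Finset.univ sc8 y x := by
  refine ⟨Finset.mem_univ _, Finset.mem_univ _, hp, ?_⟩
  rintro ⟨l, -, -, hm, he, hw⟩
  have hyl : y ∈ l := (List.of_mem_zip he).1
  have hxl : x ∈ l := by simpa using (List.of_mem_zip he).2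
  exact hy (cycle_closed hxl hx (fun e hel h1 => hc e.1 h1 e.2 (hw e hel) (hm e hel)) y hyl)

/-- Defeat certificates: for each alternative other than `0`, a defeater and a closed set. -/
def defeater : Fin 8 → Fin 8 := ![0, 0, 4, 1, 3, 7, 2, 4]

/-- The closed sets of the defeat certificates. -/
def sepSet : Fin 8 → Finset (Fin 8) := ![∅, {1, 2, 3, 4, 5, 6, 7}, {2}, {3}, {2, 4}, {5}, {6}, {7}]

theorem defeater_spec : ∀ x : Fin 8, x ≠ 0 → sc8 (defeater x, x) (x, defeater x) ∧
    x ∈ sepSet x ∧ defeater x ∉ sepSet x ∧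
    ∀ u ∈ sepSet x, ∀ v, ¬ sc8 (defeater x, x) (u, v) → sc8 (u, v) (v, u) → v ∈ sepSet x := by
  decide +kernel

theorem defeated (x : Fin 8) (hx : x ≠ 0) : SCdefeats Finset.univ sc8 (defeater x) x := by
  obtain ⟨h1, h2, h3, h4⟩ := defeater_spec x hx
  exact defeats_of_closed _ _ _ h1 h2 h3 h4

/-- Cycles showing that `0` is undefeated. -/
def cyc : Fin 8 → List (Fin 8) := ![[], [], [0, 1, 2], [0, 1, 3], [0, 1, 4], [0, 1, 5], [0, 1, 2, 6], []]

theorem cyc_spec : ∀ b : Fin 8, sc8 (b, 0) (0, b) → (cyc b).Nodup ∧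
    (∀ e ∈ (cyc b).zip ((cyc b).rotate 1), sc8 (e.1, e.2) (e.2, e.1)) ∧
    (b, 0) ∈ (cyc b).zip ((cyc b).rotate 1) ∧
    (∀ e ∈ (cyc b).zip ((cyc b).rotate 1), ¬ sc8 (b, 0) (e.1, e.2)) := by
  decide +kernel

theorem zero_winner : SCwinner Finset.univ sc8 0 := by
  refine ⟨Finset.mem_univ _, ?_⟩
  rintro b - ⟨-, -, h, hn⟩
  obtain ⟨h1, h2, h3, h4⟩ := cyc_spec b h
  exact hn ⟨cyc b, h1, fun _ _ => Finset.mem_univ _, h2, h3, h4⟩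

/-- The table of SSV winners of all subsets, as base-8 digits indexed by bit masks. -/
def ssvTable : ℕ :=
  228565214410780007493209902236838087926934343773785623455474647875016139190532455851823400263684037414767946901410556197824121949377401372751999273061703810425905853192127712923365260678594577572454444089215599641991925361807794240

/-- The SSV winner of a nonempty set of alternatives. -/
def ssvW (V : Finset (Fin 8)) : Fin 8 :=
  Fin.ofNat 8 (ssvTable / 8 ^ (∑ i ∈ V, 2 ^ (i : ℕ)))

theorem ssvW_single : ∀ a : Fin 8, ssvW {a} = a := by decide +kernel

theorem ssvW_spec : ∀ V : Finset (Fin 8), 1 < V.card →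
    ∃ b ∈ V, ssvW (V.erase b) = ssvW V ∧ ssvW V ∈ V.erase b ∧
      ∀ d ∈ V, d ≠ b → sc8 (ssvW V, b) (ssvW (V.erase d), d) := by
  decide +kernel

theorem ssv_iff : ∀ (n : ℕ) (V : Finset (Fin 8)), V.card = n + 1 → ∀ a,
    SSVwinAux sc8 (n + 1) V a ↔ a = ssvW V := by
  intro n
  induction n with
  | zero =>
    intro V hV a
    obtain ⟨x, rfl⟩ := Finset.card_eq_one.mp hV
    simp [SSVwinAux, ssvW_single, eq_comm]
  | succ n ih =>
    intro V hV a
    have hcard : ∀ d ∈ V, (V.erase d).card = n + 1 := by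
      intro d hd
      rw [Finset.card_erase_of_mem hd]
      omega
    obtain ⟨b, hb, hw, hm, hmax⟩ := ssvW_spec V (by omega)
    rw [SSVwinAux]
    constructor
    · rintro (h | ⟨-, b', hb', ha', hs, hall⟩)
      · rw [h, Finset.card_singleton] at hV
        omega
      · rw [ih _ (hcard b' hb')] at hs
        by_cases hbb : b' = b
        · rw [hs, hbb, hw]
        · exfalso
          have h1 := hmax b' hb' hbb
          have h2 := hall (ssvW V) b hb hm (fun h => hbb (Prod.mk.inj h).2.symm)
            ((ih _ (hcard b hb) _).2 hw.symm)
          rw [← hs] at h1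
          unfold sc8 at h1 h2
          omega
    · rintro rfl
      refine Or.inr ⟨by omega, b, hb, hm, (ih _ (hcard b hb) _).2 hw.symm, ?_⟩
      intro c d hd _ hne hs
      rw [ih _ (hcard d hd)] at hs
      subst hs
      refine hmax d hd ?_
      rintro rfl
      exact hne (by rw [hw])

theorem ssv_one : SSVwin Finset.univ sc8 1 :=
  (ssv_iff 7 Finset.univ (by simp) 1).2 (by decide +kernel)

/-- There exists a linear ordinal margin matrix with exactly 8 alternatives
that has exactly one Split Cycle winner, and this unique Split Cycle winner
Split-Cycle-defeats the SSV winner; in particular the SSV winner is not a Split Cycle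
winner. -/
theorem ssv_defeated_by_unique_sc_winner_eight :
    ∃ succ : Fin 8 × Fin 8 → Fin 8 × Fin 8 → Prop,
      IsLinearOMM (Finset.univ : Finset (Fin 8)) succ ∧
      ∃ w, SCwinner Finset.univ succ w ∧ (∀ w', SCwinner Finset.univ succ w' → w' = w) ∧
        ∃ a, SSVwin Finset.univ succ a ∧ SCdefeats Finset.univ succ w a ∧
          ¬ SCwinner Finset.univ succ a := by
  refine ⟨sc8, sc8_linear, 0, zero_winner, ?_, 1, ssv_one, defeated 1 (by decide), ?_⟩
  · intro w' hw'
    by_contra h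
    exact hw'.2 _ (Finset.mem_univ _) (defeated w' h)
  · intro h
    exact h.2 _ (Finset.mem_univ _) (defeated 1 (by decide))
end

section
/- For any ordinal margin matrix M = (X, ≻), every SSV-PUT winner of M is well defined and the set of SSV-PUT winners is nonempty; moreover, if M is linear, then the set of SSV-PUT winners of M is exactly the singleton consisting of the SSV winner of M. -/
variable {X : Type} [DecidableEq X]

/-- A relation that is transitive and total on a nonempty finite set has a greatest element. -/
theorem aux_exists_top {α : Type} (r : α → α → Prop) (S : Finset α) (hS : S.Nonempty)
    (htr : ∀ x ∈ S, ∀ y ∈ S, ∀ z ∈ S, r x y → r y z → r x z)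
    (htot : ∀ x ∈ S, ∀ y ∈ S, x ≠ y → r x y ∨ r y x) :
    ∃ m ∈ S, ∀ x ∈ S, x ≠ m → r m x := by
  classical
  induction hS using Finset.Nonempty.cons_induction with
  | singleton a => exact ⟨a, by simp, by simp⟩
  | cons a s ha hs ih =>
    obtain ⟨m, hm, hmx⟩ := ih
      (fun x hx y hy z hz => htr x (Finset.mem_cons_of_mem hx) y (Finset.mem_cons_of_mem hy) z
        (Finset.mem_cons_of_mem hz))
      (fun x hx y hy => htot x (Finset.mem_cons_of_mem hx) y (Finset.mem_cons_of_mem hy))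
    have hma : a ≠ m := fun h => ha (h ▸ hm)
    have hmc : m ∈ Finset.cons a s ha := Finset.mem_cons_of_mem hm
    have hac : a ∈ Finset.cons a s ha := Finset.mem_cons_self a s
    rcases htot a hac m hmc hma with h | h
    · refine ⟨a, hac, fun x hx hxa => ?_⟩
      have hxs : x ∈ s := by simpa [hxa] using hx
      by_cases hxm : x = m
      · exact hxm ▸ h
      · exact htr a hac m hmc x hx h (hmx x hxs hxm)
    · refine ⟨m, hmc, fun x hx hxm => ?_⟩
      rcases Finset.mem_cons.1 hx with rfl | hxs
      · exact h
      · exact hmx x hxs hxm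

theorem aux_trans {X : Type} [DecidableEq X] {V : Finset X} {succ : X × X → X × X → Prop}
    (h : IsOMM V succ) (p q r : X × X) (hp1 : p.1 ∈ V) (hp2 : p.2 ∈ V) (hq1 : q.1 ∈ V)
    (hq2 : q.2 ∈ V) (hr1 : r.1 ∈ V) (hr2 : r.2 ∈ V) (hpq : succ p q) (hqr : succ q r) :
    succ p r := by
  obtain ⟨_, has, hnt, _⟩ := h
  by_contra hpr
  exact hnt p r q hp1 hp2 hr1 hr2 hq1 hq2 hpr (has q r hq1 hq2 hr1 hr2 hqr) hpq

/-- In a linear matrix, every nonempty subset has a unique SSV winner. -/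
theorem aux_unique {X : Type} [DecidableEq X] {V : Finset X} {succ : X × X → X × X → Prop}
    (h : IsLinearOMM V succ) (n : ℕ) : ∀ W : Finset X, W ⊆ V → W.card = n + 1 →
      ∃ w ∈ W, ∀ a, SSVwinAux succ (n + 1) W a ↔ a = w := by
  classical
  induction n with
  | zero =>
    intro W _ hc
    obtain ⟨w, rfl⟩ := Finset.card_eq_one.1 hc
    refine ⟨w, by simp, fun a => ?_⟩
    simp [SSVwinAux, eq_comm]
  | succ n ih =>
    intro W hW hc
    have hcd : 1 < W.card := by omega
    have hne : ∀ a, W ≠ {a} := by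
      rintro a rfl
      simp at hcd
    let S : Finset (X × X) := (W ×ˢ W).filter
      (fun p => p.1 ∈ W.erase p.2 ∧ SSVwinAux succ (n + 1) (W.erase p.2) p.1)
    have hSm : ∀ p : X × X, p ∈ S ↔
        p.2 ∈ W ∧ p.1 ∈ W.erase p.2 ∧ SSVwinAux succ (n + 1) (W.erase p.2) p.1 := by
      intro p
      simp only [S, Finset.mem_filter, Finset.mem_product, Finset.mem_erase]
      tauto
    have hS1 : ∀ p ∈ S, p.1 ∈ V := fun p hp =>
      hW (Finset.mem_of_mem_erase ((hSm p).1 hp).2.1)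
    have hS2 : ∀ p ∈ S, p.2 ∈ V := fun p hp => hW ((hSm p).1 hp).1
    have hS3 : ∀ p ∈ S, p.1 ≠ p.2 := fun p hp => Finset.ne_of_mem_erase ((hSm p).1 hp).2.1
    have hSne : S.Nonempty := by
      obtain ⟨b, hb⟩ : W.Nonempty := Finset.card_pos.1 (by omega)
      obtain ⟨w, hw, hu⟩ := ih (W.erase b) ((Finset.erase_subset _ _).trans hW)
        (by rw [Finset.card_erase_of_mem hb]; omega)
      exact ⟨(w, b), (hSm _).2 ⟨hb, hw, (hu w).2 rfl⟩⟩
    obtain ⟨m, hm, hmx⟩ := aux_exists_top succ S hSne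
      (fun x hx y hy z hz => aux_trans h.1 x y z (hS1 x hx) (hS2 x hx) (hS1 y hy) (hS2 y hy)
        (hS1 z hz) (hS2 z hz))
      (fun x hx y hy hxy => h.2 x.1 x.2 y.1 y.2 (hS1 x hx) (hS2 x hx) (hS1 y hy) (hS2 y hy)
        (hS3 x hx) (hS3 y hy) hxy)
    have hm' := (hSm m).1 hm
    refine ⟨m.1, Finset.mem_of_mem_erase hm'.2.1, fun a => ⟨fun ha => ?_, ?_⟩⟩
    · rw [SSVwinAux] at ha
      rcases ha with ha | ⟨_, b, hb, hab, hwin, hmax⟩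
      · exact absurd ha (hne a)
      · by_contra hne'
        have hmab : m ≠ (a, b) := fun e => hne' (by rw [e])
        have habS : (a, b) ∈ S := (hSm _).2 ⟨hb, hab, hwin⟩
        exact h.1.2.1 m (a, b) (hS1 m hm) (hS2 m hm) (hS1 _ habS) (hS2 _ habS)
          (hmx _ habS hmab.symm) (hmax m.1 m.2 hm'.1 hm'.2.1 hmab hm'.2.2)
    · rintro rfl
      rw [SSVwinAux]
      exact Or.inr ⟨hcd, m.2, hm'.1, hm'.2.1, hm'.2.2, fun c d hd hcd' hne' hw =>
        hmx (c, d) ((hSm _).2 ⟨hd, hcd', hw⟩) hne'⟩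

theorem aux_unique' {X : Type} [DecidableEq X] {V : Finset X} {succ : X × X → X × X → Prop}
    (h : IsLinearOMM V succ) : ∃ w, ∀ a, SSVwin V succ a ↔ a = w := by
  have hpos := Finset.card_pos.2 h.1.1
  obtain ⟨n, hn⟩ : ∃ n, V.card = n + 1 := ⟨V.card - 1, by omega⟩
  obtain ⟨w, _, hw⟩ := aux_unique h n V subset_rfl hn
  exact ⟨w, by simpa [SSVwin, hn] using hw⟩

/-- SSV winners depend only on the comparison of distinct off-diagonal pairs. -/
theorem aux_congr {X : Type} [DecidableEq X] {V : Finset X} {s s' : X × X → X × X → Prop}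
    (hs : ∀ a b c d : X, a ∈ V → b ∈ V → c ∈ V → d ∈ V → a ≠ b → c ≠ d → (a, b) ≠ (c, d) →
      (s (a, b) (c, d) ↔ s' (a, b) (c, d))) (n : ℕ) : ∀ W : Finset X, W ⊆ V → ∀ a,
      (SSVwinAux s n W a ↔ SSVwinAux s' n W a) := by
  induction n with
  | zero => intro W _ a; simp [SSVwinAux]
  | succ n ih =>
    intro W hW a
    have ih' : ∀ b c, SSVwinAux s n (W.erase b) c ↔ SSVwinAux s' n (W.erase b) c :=
      fun b c => ih _ ((Finset.erase_subset _ _).trans hW) c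
    rw [SSVwinAux, SSVwinAux]
    simp only [ih']
    refine or_congr_right (and_congr_right fun _ => exists_congr fun b =>
      and_congr_right fun hb => and_congr_right fun hab => and_congr_right fun _ =>
      forall_congr' fun c => forall_congr' fun d => forall_congr' fun hd =>
      forall_congr' fun hcd => forall_congr' fun hne => forall_congr' fun _ => ?_)
    exact hs a b c d (hW (Finset.mem_of_mem_erase hab)) (hW hb)
      (hW (Finset.mem_of_mem_erase hcd)) (hW hd) (Finset.ne_of_mem_erase hab)
      (Finset.ne_of_mem_erase hcd) hne.symm

/-- A skew-symmetric integer function, injective on off-diagonal pairs. -/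
def auxT {X : Type} (e : X → ℕ) (p : X × X) : ℤ :=
  if e p.2 < e p.1 then 1 + (Nat.pair (e p.1) (e p.2) : ℤ)
  else if e p.1 < e p.2 then -(1 + (Nat.pair (e p.2) (e p.1) : ℤ)) else 0

theorem auxT_skew {X : Type} (e : X → ℕ) (a b : X) : auxT e (b, a) = - auxT e (a, b) := by
  unfold auxT
  simp only
  split_ifs <;> first | omega | simp

theorem auxT_inj {X : Type} (e : X → ℕ) (a b c d : X) (hab : e a ≠ e b) (hcd : e c ≠ e d)
    (h : auxT e (a, b) = auxT e (c, d)) : e a = e c ∧ e b = e d := by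
  unfold auxT at h
  simp only at h
  split_ifs at h <;> try omega
  · have h' : Nat.pair (e a) (e b) = Nat.pair (e c) (e d) := by omega
    exact Nat.pair_eq_pair.1 h'
  · have h' : Nat.pair (e b) (e a) = Nat.pair (e d) (e c) := by omega
    exact (Nat.pair_eq_pair.1 h').symm

theorem aux_linearization {X : Type} [DecidableEq X] (V : Finset X)
    (succ : X × X → X × X → Prop) (h : IsOMM V succ) :
    ∃ succ', IsLinearization V succ succ' := by
  obtain ⟨e, he⟩ := Set.countable_iff_exists_injOn.1 V.finite_toSet.countable
  obtain ⟨hne, has, hnt, hsk⟩ := h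
  refine ⟨fun p q => succ p q ∨ (¬ succ q p ∧ auxT e q < auxT e p),
    ⟨⟨hne, ?_, ?_, ?_⟩, ?_⟩, fun p q _ _ _ _ hpq => Or.inl hpq⟩
  · rintro p q hp1 hp2 hq1 hq2 hpq hqp
    have h1 := has p q hp1 hp2 hq1 hq2
    have h2 := has q p hq1 hq2 hp1 hp2
    rcases hpq with hpq | ⟨hpq, hlt⟩ <;> rcases hqp with hqp | ⟨hqp, hlt'⟩
    · exact h1 hpq hqp
    · exact hqp hpq
    · exact hpq hqp
    · omega
  · intro p q r hp1 hp2 hq1 hq2 hr1 hr2 hpq hqr hpr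
    have t1 := hnt p q r hp1 hp2 hq1 hq2 hr1 hr2
    have t2 := hnt r p q hr1 hr2 hp1 hp2 hq1 hq2
    have t3 := hnt q r p hq1 hq2 hr1 hr2 hp1 hp2
    push Not at hpq hqr
    obtain ⟨hpq, hpq'⟩ := hpq
    obtain ⟨hqr, hqr'⟩ := hqr
    rcases hpr with hpr | ⟨hpr, hlt⟩
    · exact t1 hpq hqr hpr
    · have h1 := hpq' (fun hqp => t3 hqr hpr hqp)
      have h2 := hqr' (fun hrq => t2 hpr hpq hrq)
      omega
  · intro a b c d ha hb hc hd
    have h1 := hsk a b c d ha hb hc hd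
    have h2 := hsk c d a b hc hd ha hb
    simp only [h1, h2]
    rw [auxT_skew e a b, auxT_skew e c d, neg_lt_neg_iff]
  · intro a b c d ha hb hc hd hab hcd hne'
    have hT : auxT e (a, b) ≠ auxT e (c, d) := by
      intro hT
      obtain ⟨h1, h2⟩ := auxT_inj e a b c d (fun hh => hab (he ha hb hh))
        (fun hh => hcd (he hc hd hh)) hT
      exact hne' (by rw [he ha hc h1, he hb hd h2])
    rcases lt_or_gt_of_ne hT with hT | hT <;> tauto

/-- For any ordinal margin matrix `M`, the set of SSV-PUT winners is nonempty;
moreover, if `M` is linear, then the set of SSV-PUT winners of `M` is exactly the singleton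
consisting of the SSV winner of `M`. -/
theorem ssvput_nonempty_and_singleton_of_linear {X : Type} [DecidableEq X] (V : Finset X)
    (succ : X × X → X × X → Prop) (h : IsOMM V succ) :
    (∃ a, SSVPUTwin V succ a) ∧
    (IsLinearOMM V succ → ∃ w, SSVwin V succ w ∧ ∀ a, (SSVPUTwin V succ a ↔ a = w)) := by
  constructor
  · obtain ⟨s', hs'⟩ := aux_linearization V succ h
    obtain ⟨w, hw⟩ := aux_unique' hs'.1
    exact ⟨w, s', hs', (hw w).2 rfl⟩
  · intro hl
    obtain ⟨w, hw⟩ := aux_unique' hl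
    refine ⟨w, (hw w).2 rfl, fun a => ⟨?_, ?_⟩⟩
    · rintro ⟨s', hs', ha⟩
      refine (hw a).1 ((aux_congr (V := V) ?_ V.card V subset_rfl a).2 ha)
      intro a b c d ha hb hc hd hab hcd hne
      refine ⟨hs'.2 (a, b) (c, d) ha hb hc hd, fun h' => ?_⟩
      rcases hl.2 a b c d ha hb hc hd hab hcd hne with h1 | h1
      · exact h1
      · exact absurd (hs'.2 (c, d) (a, b) hc hd ha hb h1)
          (hs'.1.1.2.1 (a, b) (c, d) ha hb hc hd h')
    · rintro rfl
      exact ⟨succ, ⟨hl, fun _ _ _ _ _ _ h => h⟩, (hw a).2 rfl⟩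
end
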